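/- arXiv:2602.22068 — 8 statements merged into one kernel-verified Lean document; each statement's English description precedes it below -/
import Mathlib

section
/- For every ε > 0 and all ξ₁, ξ₂ ∈ ℝ one has the identity ε^κ (P(ξ₁/ε + ξ₂) − P(ξ₂)) = ( Σ_{0 ≤ 2j < κ} ε^{2j} · (d_{κ−2j} / 2^{κ−2j−1}) · Q_{κ−2j}(ξ₁², (ξ₁ + 2εξ₂)²) ) · ξ₁ · (ξ₁ + 2εξ₂)^{ς(κ)}. -/
open MeasureTheory Real
open scoped ENNReal NNReal

/-- The dispersion symbol `P(y) = Σ_{0 ≤ 2j < κ} d_{κ−2j} y^{κ−2j}`. -/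
noncomputable def P (κ : ℕ) (d : ℕ → ℝ) (y : ℝ) : ℝ :=
  ∑ j ∈ Finset.range ((κ + 1) / 2), d (κ - 2 * j) * y ^ (κ - 2 * j)

/-- `ς(κ) = 1` if `κ` is even, `0` if `κ` is odd. -/
def ς (κ : ℕ) : ℕ := if Even κ then 1 else 0

/-- The polynomial `Q_r(x,y)`: for `r = 2p`, `Σ_{j=0}^{p−1} C(r,2j+1) x^j y^{p−1−j}`;
for `r = 2p+1`, `Σ_{j=0}^{p} C(r,2j+1) x^j y^{p−j}`. -/
noncomputable def Q (r : ℕ) (x y : ℝ) : ℝ :=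
  if Even r then
    ∑ j ∈ Finset.range (r / 2), (r.choose (2 * j + 1) : ℝ) * x ^ j * y ^ (r / 2 - 1 - j)
  else
    ∑ j ∈ Finset.range (r / 2 + 1), (r.choose (2 * j + 1) : ℝ) * x ^ j * y ^ (r / 2 - j)

lemma sum_range_two_mul {M : Type*} [AddCommMonoid M] (f : ℕ → M) (n : ℕ) :
    ∑ m ∈ Finset.range (2 * n), f m =
      ∑ j ∈ Finset.range n, (f (2 * j) + f (2 * j + 1)) := by
  induction n with
  | zero => simp
  | succ n ih =>
    rw [show 2 * (n + 1) = 2 * n + 1 + 1 by ring, Finset.sum_range_succ, Finset.sum_range_succ,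
      ih, Finset.sum_range_succ, add_assoc]

/-- The odd part in `a` of the binomial expansion, written through `Q`. -/
lemma add_pow_sub_sub_pow_eq_Q (r : ℕ) (a b : ℝ) :
    (a + b) ^ r - (b - a) ^ r = 2 * (Q r (a ^ 2) (b ^ 2) * a * b ^ ς r) := by
  have hsub : (a + b) ^ r - (b - a) ^ r =
      ∑ m ∈ Finset.range (r + 1), (a ^ m - (-a) ^ m) * b ^ (r - m) * (r.choose m : ℝ) := by
    rw [show b - a = -a + b by ring, add_pow, add_pow, ← Finset.sum_sub_distrib]
    exact Finset.sum_congr rfl fun m _ => by ring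
  have heven : ∀ j : ℕ, a ^ (2 * j) - (-a) ^ (2 * j) = 0 := fun j => by simp [pow_mul]
  have hodd : ∀ j : ℕ, a ^ (2 * j + 1) - (-a) ^ (2 * j + 1) = 2 * ((a ^ 2) ^ j * a) := fun j => by
    rw [pow_succ, pow_succ, pow_mul, pow_mul, neg_sq]; ring
  rw [hsub]
  rcases Nat.even_or_odd' r with ⟨p, rfl | rfl⟩
  · have hr : Even (2 * p) := even_two_mul p
    rw [Finset.sum_range_succ, heven, sum_range_two_mul, Q, ς, if_pos hr, if_pos hr,
      Nat.mul_div_cancel_left p two_pos, Finset.sum_mul, Finset.sum_mul, Finset.mul_sum,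
      zero_mul, zero_mul, add_zero]
    refine Finset.sum_congr rfl fun j hj => ?_
    have hj : j < p := Finset.mem_range.mp hj
    rw [heven, hodd, show 2 * p - (2 * j + 1) = 2 * (p - 1 - j) + 1 by omega, pow_succ b,
      pow_mul b]
    ring
  · have hr : ¬ Even (2 * p + 1) := by simp
    rw [show 2 * p + 1 + 1 = 2 * (p + 1) by ring, sum_range_two_mul, Q, ς, if_neg hr, if_neg hr,
      show (2 * p + 1) / 2 = p by omega, Finset.sum_mul, Finset.sum_mul, Finset.mul_sum]
    refine Finset.sum_congr rfl fun j hj => ?_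
    have hj : j < p + 1 := Finset.mem_range.mp hj
    rw [heven, hodd, show 2 * p + 1 - (2 * j + 1) = 2 * (p - j) by omega, pow_mul b]
    ring

/-- The factorization of the rescaled phase of a single monomial. -/
lemma pow_mul_pow_sub_pow_eq_Q {r : ℕ} (hr : 1 ≤ r) {ε : ℝ} (hε : ε ≠ 0) (x y : ℝ) :
    ε ^ r * ((x / ε + y) ^ r - y ^ r) =
      Q r (x ^ 2) ((x + 2 * ε * y) ^ 2) / 2 ^ (r - 1) * x * (x + 2 * ε * y) ^ ς r := by
  have h := add_pow_sub_sub_pow_eq_Q r x (x + 2 * ε * y)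
  rw [show x + (x + 2 * ε * y) = 2 * (ε * (x / ε + y)) by field_simp; ring,
    show x + 2 * ε * y - x = 2 * (ε * y) by ring, mul_pow, mul_pow, mul_pow, mul_pow,
    show (2 : ℝ) ^ r = 2 * 2 ^ (r - 1) by rw [← pow_succ', Nat.sub_add_cancel hr]] at h
  rw [div_mul_eq_mul_div, div_mul_eq_mul_div, eq_div_iff (by positivity)]
  linear_combination h / 2

lemma ς_sub_two_mul {κ j : ℕ} (h : 2 * j ≤ κ) : ς (κ - 2 * j) = ς κ := by
  simp [ς, Nat.even_sub h]

/-- Algebraic factorization of the rescaled phase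
`ε^κ (P(ξ₁/ε + ξ₂) − P(ξ₂))`. -/
theorem phase_factorization (κ : ℕ) (hκ : 2 ≤ κ) (d : ℕ → ℝ) (hd : d κ = 1)
    (ε : ℝ) (hε : 0 < ε) (ξ₁ ξ₂ : ℝ) :
    ε ^ κ * (P κ d (ξ₁ / ε + ξ₂) - P κ d ξ₂) =
      (∑ j ∈ Finset.range ((κ + 1) / 2),
          ε ^ (2 * j) * (d (κ - 2 * j) / 2 ^ (κ - 2 * j - 1)) *
            Q (κ - 2 * j) (ξ₁ ^ 2) ((ξ₁ + 2 * ε * ξ₂) ^ 2)) *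
        ξ₁ * (ξ₁ + 2 * ε * ξ₂) ^ ς κ := by
  rw [P, P, ← Finset.sum_sub_distrib, Finset.mul_sum, Finset.sum_mul, Finset.sum_mul]
  refine Finset.sum_congr rfl fun j hj => ?_
  have hj : 2 * j < κ := by
    have := Finset.mem_range.mp hj
    omega
  have h := pow_mul_pow_sub_pow_eq_Q (r := κ - 2 * j) (by omega) hε.ne' ξ₁ ξ₂
  rw [ς_sub_two_mul hj.le] at h
  rw [show ε ^ κ = ε ^ (2 * j) * ε ^ (κ - 2 * j) by rw [← pow_add, Nat.add_sub_cancel' hj.le]]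
  linear_combination ε ^ (2 * j) * d (κ - 2 * j) * h
end

section
/- There exist constants C₀ ≥ 1 and c > 0, depending only on κ and the coefficients d_{κ−2j}, such that for every ε > 0 and all ξ₁, ξ₂ ∈ ℝ with |ξ₁| ≥ C₀ε or |ξ₁ + 2εξ₂| ≥ C₀ε, one has |ε^κ (P(ξ₁/ε + ξ₂) − P(ξ₂))| ≥ c · |ξ₁| · |ξ₁ + 2εξ₂|^{ς(κ)} · ( |ξ₁|^{κ−1−ς(κ)} + |ξ₁ + 2εξ₂|^{κ−1−ς(κ)} ). -/
open MeasureTheory Real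
open scoped ENNReal NNReal

lemma add_mul_pow_add_pow_nonneg (k : ℕ) (a b : ℝ) :
    0 ≤ (a + b) * (a ^ (2 * k + 1) + b ^ (2 * k + 1)) := by
  have hmono : StrictMono fun x : ℝ => x ^ (2 * k + 1) := Odd.strictMono_pow ⟨k, rfl⟩
  have hneg : (-b) ^ (2 * k + 1) = -b ^ (2 * k + 1) := Odd.neg_pow ⟨k, rfl⟩ b
  rcases le_total (-b) a with h | h
  · have := hmono.monotone h
    simp only [hneg] at this
    exact mul_nonneg (by linarith) (by linarith)
  · have := hmono.monotone h
    simp only [hneg] at this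
    exact mul_nonneg_of_nonpos_of_nonpos (by linarith) (by linarith)

/-- Each difference of powers `a ^ p - b ^ p`, with `p = 2k + 1 + s`, `u = a - b`, `v = a + b`,
factors as `u * v ^ s` times a positive definite form of degree `2k` in `(u, v)`. -/
lemma exists_factor_pow_sub_pow {s : ℕ} (hs : s = 0 ∨ s = 1) (k : ℕ) :
    ∃ c : ℝ, 0 < c ∧ ∃ K : ℝ, 0 < K ∧ ∀ u v : ℝ, ∃ q : ℝ,
      ((u + v) / 2) ^ (2 * k + 1 + s) - ((v - u) / 2) ^ (2 * k + 1 + s) = u * v ^ s * q ∧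
      c * (|u| ^ (2 * k) + |v| ^ (2 * k)) ≤ q ∧ q ≤ K * max |u| |v| ^ (2 * k) := by
  induction k with
  | zero =>
    refine ⟨1 / 2, by norm_num, 1, one_pos, fun u v => ⟨1, ?_, by norm_num, by norm_num⟩⟩
    rcases hs with rfl | rfl <;> ring
  | succ k ih =>
    obtain ⟨c, hc, K, hK, h⟩ := ih
    refine ⟨c / 4, by positivity, K + 1, by positivity, fun u v => ?_⟩
    obtain ⟨q, hq, hcq, hqK⟩ := h u v
    obtain ⟨a, ha⟩ : ∃ a, a = (u + v) / 2 := ⟨_, rfl⟩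
    obtain ⟨b, hb⟩ : ∃ b, b = (v - u) / 2 := ⟨_, rfl⟩
    obtain ⟨M, hM⟩ : ∃ M, M = max |u| |v| := ⟨_, rfl⟩
    have huM : |u| ≤ M := hM ▸ le_max_left _ _
    have hvM : |v| ≤ M := hM ▸ le_max_right _ _
    have hM0 : 0 ≤ M := (abs_nonneg u).trans huM
    have hab : |a| ≤ M ∧ |b| ≤ M := by
      rw [ha, hb, abs_le, abs_le]
      obtain ⟨h1, h2⟩ := abs_le.1 huM
      obtain ⟨h3, h4⟩ := abs_le.1 hvM
      refine ⟨⟨?_, ?_⟩, ?_, ?_⟩ <;> linarith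
    have hu : u = a - b := by rw [ha, hb]; ring
    have hv : v = a + b := by rw [ha, hb]; ring
    have hq0 : 0 ≤ q := le_trans (by positivity) hcq
    obtain ⟨t, htq, ht0, htM⟩ : ∃ t : ℝ,
        u * v * (a ^ (2 * k + 1 + s) + b ^ (2 * k + 1 + s)) = u * v ^ s * t ∧ 0 ≤ t ∧
          t ≤ 2 * M ^ (2 * (k + 1)) := by
      have hpow : ∀ n : ℕ, |a ^ n + b ^ n| ≤ 2 * M ^ n := fun n =>
        calc |a ^ n + b ^ n| ≤ |a| ^ n + |b| ^ n := by
              simpa only [abs_pow] using abs_add_le (a ^ n) (b ^ n)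
          _ ≤ M ^ n + M ^ n := by gcongr; exacts [hab.1, hab.2]
          _ = 2 * M ^ n := by ring
      rcases hs with rfl | rfl
      · refine ⟨v * (a ^ (2 * k + 1) + b ^ (2 * k + 1)), by ring, ?_, ?_⟩
        · rw [hv]; exact add_mul_pow_add_pow_nonneg k a b
        · calc _ ≤ |v| * |a ^ (2 * k + 1) + b ^ (2 * k + 1)| := by
                rw [← abs_mul]; exact le_abs_self _
            _ ≤ M * (2 * M ^ (2 * k + 1)) := by gcongr; exact hpow _
            _ = _ := by ring
      · refine ⟨a ^ (2 * (k + 1)) + b ^ (2 * (k + 1)), by ring, ?_, (le_abs_self _).trans (hpow _)⟩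
        simp only [pow_mul]; positivity
    refine ⟨((a ^ 2 + b ^ 2) * q + t) / 2, ?_, ?_, ?_⟩
    · rw [← ha, ← hb] at hq ⊢
      have e : ∀ x : ℝ, x ^ (2 * (k + 1) + 1 + s) = x ^ 2 * x ^ (2 * k + 1 + s) := fun x => by ring
      rw [e, e]
      have huv : u * v = a ^ 2 - b ^ 2 := by rw [hu, hv]; ring
      rw [huv] at htq
      linear_combination (a ^ 2 + b ^ 2) / 2 * hq + htq / 2
    · have hsq : a ^ 2 + b ^ 2 = (|u| ^ 2 + |v| ^ 2) / 2 := by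
        rw [sq_abs, sq_abs, hu, hv]; ring
      have hmul : (|u| ^ 2 + |v| ^ 2) * (c * (|u| ^ (2 * k) + |v| ^ (2 * k))) ≤
          (|u| ^ 2 + |v| ^ 2) * q := by gcongr
      have hcross : 0 ≤ c * (|u| ^ 2 * |v| ^ (2 * k) + |v| ^ 2 * |u| ^ (2 * k)) := by positivity
      rw [hsq, mul_add 2 k 1, mul_one, pow_add, pow_add]
      linarith
    · have h1 : a ^ 2 + b ^ 2 ≤ 2 * M ^ 2 := by
        have h1 := pow_le_pow_left₀ (abs_nonneg a) hab.1 2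
        have h2 := pow_le_pow_left₀ (abs_nonneg b) hab.2 2
        rw [sq_abs] at h1 h2
        linarith
      rw [← hM] at hqK ⊢
      have h2 : (a ^ 2 + b ^ 2) * q ≤ 2 * M ^ 2 * (K * M ^ (2 * k)) := by gcongr
      have e : M ^ (2 * (k + 1)) = M ^ 2 * M ^ (2 * k) := by ring
      rw [e] at htM ⊢
      linarith

/-- Unscaled lower bound for a sum of powers of fixed parity `1 + s`, with leading coefficient `1`,
in terms of `u = a - b` and `v = a + b`. -/
lemma exists_lower_bound_sum_pow_sub {s : ℕ} (hs : s = 0 ∨ s = 1) (m : ℕ) (e : ℕ → ℝ)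
    (he : e m = 1) :
    ∃ C₀ : ℝ, 1 ≤ C₀ ∧ ∃ c : ℝ, 0 < c ∧ ∀ u v : ℝ, C₀ ≤ max |u| |v| →
      c * (|u| * |v| ^ s * (|u| ^ (2 * m) + |v| ^ (2 * m))) ≤
        |∑ k ∈ Finset.range (m + 1),
          e k * (((u + v) / 2) ^ (2 * k + 1 + s) - ((v - u) / 2) ^ (2 * k + 1 + s))| := by
  choose c hc K hK h using exists_factor_pow_sub_pow hs
  choose q hq hcq hqK using h
  set L : ℝ := ∑ k ∈ Finset.range m, |e k| * K k with hL
  have hL0 : 0 ≤ L := Finset.sum_nonneg fun k _ => mul_nonneg (abs_nonneg _) (hK k).le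
  have hcm := hc m
  refine ⟨1 + 2 * L / c m, le_add_of_nonneg_right (by positivity), c m / 2, by positivity,
    fun u v huv => ?_⟩
  set M := max |u| |v| with hM
  have hM1 : 1 ≤ M := le_trans (le_add_of_nonneg_right (by positivity)) huv
  set S := |u| ^ (2 * m) + |v| ^ (2 * m) with hS
  have hMS : M ^ (2 * m) ≤ S := by
    have h1 : 0 ≤ |u| ^ (2 * m) := by positivity
    have h2 : 0 ≤ |v| ^ (2 * m) := by positivity
    rcases max_choice |u| |v| with h | h <;> rw [hM, h, hS] <;> linarith
  set r := ∑ k ∈ Finset.range m, e k * q k u v with hr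
  have hsum : ∑ k ∈ Finset.range (m + 1),
      e k * (((u + v) / 2) ^ (2 * k + 1 + s) - ((v - u) / 2) ^ (2 * k + 1 + s)) =
      u * v ^ s * (r + q m u v) := by
    rw [Finset.sum_range_succ, he, one_mul, hq, mul_add, hr, Finset.mul_sum]
    congr 1
    exact Finset.sum_congr rfl fun k _ => by rw [hq]; ring
  have hrM : |r| * M ^ 2 ≤ L * M ^ (2 * m) := by
    rw [hL, Finset.sum_mul]
    calc |r| * M ^ 2 ≤ (∑ k ∈ Finset.range m, |e k * q k u v|) * M ^ 2 := by
          gcongr; exact Finset.abs_sum_le_sum_abs _ _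
      _ = ∑ k ∈ Finset.range m, |e k * q k u v| * M ^ 2 := Finset.sum_mul _ _ _
      _ ≤ _ := Finset.sum_le_sum fun k hk => ?_
    have hq0 : 0 ≤ q k u v := le_trans (mul_nonneg (hc k).le (by positivity)) (hcq k u v)
    have hkm : 2 * k + 2 ≤ 2 * m := by have := Finset.mem_range.1 hk; omega
    rw [abs_mul, abs_of_nonneg hq0]
    calc |e k| * q k u v * M ^ 2 ≤ |e k| * (K k * M ^ (2 * k)) * M ^ 2 := by
          gcongr; exact hqK k u v
      _ = |e k| * K k * M ^ (2 * k + 2) := by ring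
      _ ≤ |e k| * K k * M ^ (2 * m) := by
          have := (hK k).le
          gcongr
  have hM2 : 2 * L ≤ c m * M ^ 2 := by
    have h1 : 2 * L / c m ≤ M := by linarith
    rw [div_le_iff₀ hcm] at h1
    nlinarith
  have hrS : |r| ≤ c m / 2 * S := by
    have hM20 : 0 < M ^ 2 := by positivity
    refine le_of_mul_le_mul_right ?_ hM20
    have hS0 : 0 ≤ S := by positivity
    calc |r| * M ^ 2 ≤ L * S := hrM.trans (by gcongr)
      _ ≤ c m / 2 * S * M ^ 2 := by nlinarith
  have hlow : c m / 2 * S ≤ |r + q m u v| := by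
    have h1 := hcq m u v
    have h2 := neg_abs_le r
    refine le_trans ?_ (le_abs_self _)
    linarith
  rw [hsum, abs_mul, abs_mul, abs_pow]
  calc c m / 2 * (|u| * |v| ^ s * S) = |u| * |v| ^ s * (c m / 2 * S) := by ring
    _ ≤ _ := by gcongr

lemma P_eq_sum {s : ℕ} (hs : s = 0 ∨ s = 1) (m : ℕ) (d : ℕ → ℝ) (y : ℝ) :
    P (2 * m + 1 + s) d y =
      ∑ k ∈ Finset.range (m + 1), d (2 * k + 1 + s) * y ^ (2 * k + 1 + s) := by
  have hm : (2 * m + 1 + s + 1) / 2 = m + 1 := by omega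
  rw [P, hm, ← Finset.sum_range_reflect]
  refine Finset.sum_congr rfl fun j hj => ?_
  have hj := Finset.mem_range.1 hj
  have : 2 * m + 1 + s - 2 * (m + 1 - 1 - j) = 2 * j + 1 + s := by omega
  rw [this]

/-- Lower bound on the rescaled phase `ε^κ (P(ξ₁/ε + ξ₂) − P(ξ₂))` in the
non-resonant regime `|ξ₁| ≥ C₀ε` or `|ξ₁ + 2εξ₂| ≥ C₀ε`. -/
theorem phase_lower_bound (κ : ℕ) (hκ : 2 ≤ κ) (d : ℕ → ℝ) (hd : d κ = 1) :
    ∃ C₀ : ℝ, 1 ≤ C₀ ∧ ∃ c : ℝ, 0 < c ∧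
      ∀ ε : ℝ, 0 < ε → ∀ ξ₁ ξ₂ : ℝ,
        (C₀ * ε ≤ |ξ₁| ∨ C₀ * ε ≤ |ξ₁ + 2 * ε * ξ₂|) →
        c * (|ξ₁| * |ξ₁ + 2 * ε * ξ₂| ^ ς κ *
            (|ξ₁| ^ (κ - 1 - ς κ) + |ξ₁ + 2 * ε * ξ₂| ^ (κ - 1 - ς κ))) ≤
          |ε ^ κ * (P κ d (ξ₁ / ε + ξ₂) - P κ d ξ₂)| := by
  obtain ⟨s, m, hs, hsκ, rfl⟩ : ∃ s m, (s = 0 ∨ s = 1) ∧ ς κ = s ∧ κ = 2 * m + 1 + s := by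
    rcases Nat.even_or_odd κ with h | h
    · refine ⟨1, κ / 2 - 1, Or.inr rfl, if_pos h, ?_⟩
      have := Nat.even_iff.1 h
      omega
    · refine ⟨0, κ / 2, Or.inl rfl, if_neg (Nat.not_even_iff_odd.2 h), ?_⟩
      have := Nat.odd_iff.1 h
      omega
  obtain ⟨C₀, hC₀, c, hc, h⟩ :=
    exists_lower_bound_sum_pow_sub hs m (fun k => d (2 * k + 1 + s)) hd
  refine ⟨C₀, hC₀, c, hc, fun ε hε ξ₁ ξ₂ hξ => ?_⟩
  have hdeg : 2 * m + 1 + s - 1 - s = 2 * m := by omega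
  rw [hsκ, hdeg]
  obtain ⟨u, rfl⟩ : ∃ u, ξ₁ = ε * u := ⟨ξ₁ / ε, by field_simp⟩
  obtain ⟨v, hv⟩ : ∃ v, v = u + 2 * ξ₂ := ⟨_, rfl⟩
  have hεv : ε * u + 2 * ε * ξ₂ = ε * v := by rw [hv]; ring
  have ha : ε * u / ε + ξ₂ = (u + v) / 2 := by rw [hv]; field_simp; ring
  have hb : ξ₂ = (v - u) / 2 := by rw [hv]; ring
  have habs : ∀ x : ℝ, |ε * x| = ε * |x| := fun x => by rw [abs_mul, abs_of_pos hε]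
  rw [hεv, habs, habs, mul_comm C₀, mul_le_mul_iff_right₀ hε, mul_le_mul_iff_right₀ hε,
    ← le_max_iff] at hξ
  have key := h u v hξ
  simp only [mul_sub, Finset.sum_sub_distrib] at key
  rw [← P_eq_sum hs, ← P_eq_sum hs] at key
  rw [hεv, ha, habs, habs, abs_mul, abs_of_pos (pow_pos hε _)]
  rw [← hb] at key
  calc _ = ε ^ (2 * m + 1 + s) * (c * (|u| * |v| ^ s * (|u| ^ (2 * m) + |v| ^ (2 * m)))) := by ring
    _ ≤ _ := by gcongr
end

section
/- There exist constants C₀ ≥ 1 and C > 0, depending only on κ and the coefficients d_{κ−2j}, such that for every ε > 0 and all ξ₁, ξ₂ ∈ ℝ with |ξ₁| ≥ C₀ε or |ξ₁ + 2εξ₂| ≥ C₀ε, one has |ξ₁|^κ · |ξ₁ + 2εξ₂|^κ ≤ C · |ε^κ (P(ξ₁/ε + ξ₂) − P(ξ₂))| · ( |ξ₁|^κ + |ξ₁ + 2εξ₂|^κ ); equivalently, whenever the phase Φ(ξ₁,ξ₂) := ε^α(P(ξ₁/ε + ξ₂) − P(ξ₂)) is nonzero, 1/|Φ(ξ₁,ξ₂)|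 ≤ C ε^{κ−α} ( |ξ₁|^{−κ} + |ξ₁ + 2εξ₂|^{−κ} ). -/
open MeasureTheory Real
open scoped ENNReal NNReal

/-- Lower bound for a difference of powers of nonnegative reals. -/
lemma abs_sub_mul_max_pow_le {u v : ℝ} (hu : 0 ≤ u) (hv : 0 ≤ v) (n : ℕ) :
    |u - v| * max u v ^ n ≤ |u ^ (n + 1) - v ^ (n + 1)| := by
  wlog h : v ≤ u generalizing u v
  · rw [abs_sub_comm u, abs_sub_comm (u ^ _), max_comm]
    exact this hv hu (le_of_not_ge h)
  have h1 : v ^ n ≤ u ^ n := pow_le_pow_left₀ hv h n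
  rw [max_eq_left h, abs_of_nonneg (sub_nonneg.2 h)]
  refine le_trans ?_ (le_abs_self _)
  rw [pow_succ, pow_succ]
  nlinarith [mul_le_mul_of_nonneg_left h1 hv]

/-- Lower bound for a difference of odd powers of reals. -/
lemma abs_sub_mul_max_abs_pow_le_of_even (x y : ℝ) {n : ℕ} (hn : Even n) :
    |x - y| * max |x| |y| ^ n ≤ 2 * |x ^ (n + 1) - y ^ (n + 1)| := by
  wlog hx : 0 ≤ x generalizing x y
  · have := this (-x) (-y) (by linarith)
    rw [hn.add_one.neg_pow, hn.add_one.neg_pow, abs_neg, abs_neg, neg_sub_neg, neg_sub_neg,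
      abs_sub_comm y, abs_sub_comm (y ^ _)] at this
    exact this
  rcases le_total 0 y with hy | hy
  · rw [abs_of_nonneg hx, abs_of_nonneg hy]
    linarith [abs_sub_mul_max_pow_le hx hy n, abs_nonneg (x ^ (n + 1) - y ^ (n + 1))]
  · obtain ⟨z, rfl⟩ : ∃ z, y = -z := ⟨-y, by ring⟩
    have hz : 0 ≤ z := by linarith
    rw [hn.add_one.neg_pow, abs_neg, abs_of_nonneg hx, abs_of_nonneg hz, sub_neg_eq_add,
      sub_neg_eq_add, abs_of_nonneg (by positivity), abs_of_nonneg (by positivity)]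
    have hp : max x z ^ (n + 1) ≤ x ^ (n + 1) + z ^ (n + 1) := by
      rcases max_choice x z with h | h <;> rw [h]
      · linarith [pow_nonneg hz (n + 1)]
      · linarith [pow_nonneg hx (n + 1)]
    have hm : (x + z) * max x z ^ n ≤ (2 * max x z) * max x z ^ n := by
      gcongr
      linarith [le_max_left x z, le_max_right x z]
    rw [pow_succ] at hp
    linarith

/-- Differences of powers whose exponents have a common parity are comparable to a common
factor `q` times the corresponding power of `max |x| |y|`. -/
lemma exists_pow_sub_pow_factor (x y : ℝ) (hR : 0 < max |x| |y|) {κ : ℕ} (hκ : 2 ≤ κ) :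
    ∃ q : ℝ, 0 ≤ q ∧ |x - y| * |x + y| ≤ 2 * max |x| |y| ^ 2 * q ∧
      q * max |x| |y| ^ κ ≤ 2 * |x ^ κ - y ^ κ| ∧
      ∀ j, 2 * j < κ →
        |x ^ (κ - 2 * j) - y ^ (κ - 2 * j)| ≤ κ * q * max |x| |y| ^ (κ - 2 * j) := by
  set R := max |x| |y| with hRdef
  rcases Nat.even_or_odd' κ with ⟨k, rfl | rfl⟩
  · obtain ⟨n, rfl⟩ : ∃ n, k = n + 1 := ⟨k - 1, by omega⟩
    have hmax : max (x ^ 2) (y ^ 2) = R ^ 2 := by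
      rw [← sq_abs x, ← sq_abs y, hRdef]
      exact ((pow_left_monotoneOn (n := 2)).map_max (abs_nonneg x) (abs_nonneg y)).symm
    refine ⟨|x ^ 2 - y ^ 2| / R ^ 2, by positivity, ?_, ?_, ?_⟩
    · rw [← abs_mul, show (x - y) * (x + y) = x ^ 2 - y ^ 2 by ring, mul_assoc,
        mul_div_cancel₀ _ (by positivity)]
      linarith [abs_nonneg (x ^ 2 - y ^ 2)]
    · have h := abs_sub_mul_max_pow_le (sq_nonneg x) (sq_nonneg y) n
      rw [hmax] at h
      rw [pow_mul, pow_mul, pow_mul, pow_succ (R ^ 2), div_mul_eq_mul_div, ← mul_assoc,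
        mul_div_cancel_right₀ _ (by positivity)]
      linarith [abs_nonneg ((x ^ 2) ^ (n + 1) - (y ^ 2) ^ (n + 1))]
    · intro j hj
      obtain ⟨m, hm⟩ : ∃ m, n + 1 - j = m + 1 := ⟨n - j, by omega⟩
      rw [← Nat.mul_sub, hm]
      have h := abs_pow_sub_pow_le (x ^ 2) (y ^ 2) (m + 1)
      rw [abs_of_nonneg (sq_nonneg x), abs_of_nonneg (sq_nonneg y), hmax,
        Nat.add_sub_cancel] at h
      rw [pow_mul, pow_mul, pow_mul]
      have hc : ((m + 1 : ℕ) : ℝ) ≤ ((2 * (n + 1) : ℕ) : ℝ) := by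
        exact_mod_cast (by omega : m + 1 ≤ 2 * (n + 1))
      calc _ ≤ _ := h
        _ ≤ |x ^ 2 - y ^ 2| * ((2 * (n + 1) : ℕ) : ℝ) * (R ^ 2) ^ m := by gcongr
        _ = _ := by field_simp; ring
  · refine ⟨|x - y| / R, by positivity, ?_, ?_, ?_⟩
    · have h : |x + y| ≤ 2 * R := by
        linarith [abs_add_le x y, le_max_left |x| |y|, le_max_right |x| |y|]
      calc |x - y| * |x + y| ≤ |x - y| * (2 * R) := by gcongr
        _ = _ := by field_simp
    · have h := abs_sub_mul_max_abs_pow_le_of_even x y (even_two_mul k)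
      calc _ = |x - y| * R ^ (2 * k) := by field_simp; ring
        _ ≤ _ := h
    · intro j hj
      obtain ⟨m, hm⟩ : ∃ m, 2 * k + 1 - 2 * j = m + 1 := ⟨2 * k - 2 * j, by omega⟩
      rw [hm]
      have h := abs_pow_sub_pow_le x y (m + 1)
      rw [Nat.add_sub_cancel] at h
      have hc : ((m + 1 : ℕ) : ℝ) ≤ ((2 * k + 1 : ℕ) : ℝ) := by
        exact_mod_cast (by omega : m + 1 ≤ 2 * k + 1)
      calc _ ≤ _ := h
        _ ≤ |x - y| * ((2 * k + 1 : ℕ) : ℝ) * R ^ m := by gcongr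
        _ = _ := by field_simp; ring

/-- The sizes of `x - y` and `x + y` are controlled by the phase difference `P x - P y` as soon
as `x` or `y` is large. -/
lemma exists_le_abs_P_sub_P (κ : ℕ) (hκ : 2 ≤ κ) (d : ℕ → ℝ) (hd : d κ = 1) :
    ∃ R₀ : ℝ, 1 ≤ R₀ ∧ ∀ x y : ℝ, R₀ ≤ max |x| |y| →
      |x - y| * |x + y| * max |x| |y| ^ (κ - 2) ≤ 8 * |P κ d x - P κ d y| := by
  obtain ⟨N, hN⟩ : ∃ N, (κ + 1) / 2 = N + 1 := ⟨(κ + 1) / 2 - 1, by omega⟩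
  set S : ℝ := ∑ j ∈ Finset.range N, |d (κ - 2 * (j + 1))| * κ with hS
  have hS0 : 0 ≤ S := Finset.sum_nonneg fun _ _ => by positivity
  refine ⟨1 + 4 * S, by linarith, fun x y hxy => ?_⟩
  have hR : 0 < max |x| |y| := by linarith
  obtain ⟨q, hq, hab, hlow, hup⟩ := exists_pow_sub_pow_factor x y hR hκ
  set R := max |x| |y|
  have hR1 : 1 ≤ R := by linarith
  have hP : P κ d x - P κ d y = (x ^ κ - y ^ κ) +
      ∑ j ∈ Finset.range N, d (κ - 2 * (j + 1)) *
        (x ^ (κ - 2 * (j + 1)) - y ^ (κ - 2 * (j + 1))) := by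
    simp only [P, hN, Finset.sum_range_succ', mul_sub, Finset.sum_sub_distrib, mul_zero,
      Nat.sub_zero, hd, one_mul]
    ring
  have htail : |∑ j ∈ Finset.range N, d (κ - 2 * (j + 1)) *
      (x ^ (κ - 2 * (j + 1)) - y ^ (κ - 2 * (j + 1)))| ≤ S * (q * R ^ (κ - 1)) := by
    refine (Finset.abs_sum_le_sum_abs _ _).trans ?_
    rw [hS, Finset.sum_mul]
    refine Finset.sum_le_sum fun j hj => ?_
    have hj' := Finset.mem_range.1 hj
    rw [abs_mul, mul_assoc]
    refine mul_le_mul_of_nonneg_left ((hup (j + 1) (by omega)).trans ?_) (abs_nonneg _)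
    have hexp : R ^ (κ - 2 * (j + 1)) ≤ R ^ (κ - 1) := pow_le_pow_right₀ hR1 (by omega)
    rw [mul_assoc]
    gcongr
  have hpow : R ^ κ = R ^ (κ - 1) * R := by
    rw [← pow_succ]; congr 1; omega
  have hpow2 : R ^ κ = R ^ (κ - 2) * R ^ 2 := by
    rw [← pow_add]; congr 1; omega
  have hmain : S * (q * R ^ (κ - 1)) * 4 ≤ q * R ^ κ := by
    have : q * R ^ (κ - 1) * (4 * S) ≤ q * R ^ (κ - 1) * R := by
      gcongr; linarith
    rw [hpow]; linarith
  have hge : q * R ^ κ ≤ 4 * |P κ d x - P κ d y| := by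
    rw [hP]
    have := abs_sub_abs_le_abs_add (x ^ κ - y ^ κ) (∑ j ∈ Finset.range N,
      d (κ - 2 * (j + 1)) * (x ^ (κ - 2 * (j + 1)) - y ^ (κ - 2 * (j + 1))))
    linarith
  calc _ ≤ 2 * R ^ 2 * q * R ^ (κ - 2) := by gcongr
    _ = 2 * (q * R ^ κ) := by rw [hpow2]; ring
    _ ≤ _ := by linarith

/-- A product of `κ`-th powers is bounded by a sum of `κ`-th powers times a mixed product. -/
lemma pow_mul_pow_le_mul_add {a b R : ℝ} (ha : 0 ≤ a) (hb : 0 ≤ b) (hR : a + b ≤ 2 * R)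
    {κ : ℕ} (hκ : 2 ≤ κ) :
    a ^ κ * b ^ κ ≤ a * b * R ^ (κ - 2) * (a ^ κ + b ^ κ) := by
  wlog h : a ≤ b generalizing a b
  · have := this hb ha (by linarith) (le_of_not_ge h)
    rw [mul_comm b a, add_comm (b ^ κ)] at this
    linarith
  have haR : a ≤ R := by linarith
  have hR0 : 0 ≤ R := ha.trans haR
  have hpow : a ^ κ = a * a * a ^ (κ - 2) := by
    rw [← sq, ← pow_add]; congr 1; omega
  have h1 : a ^ κ ≤ a * b * R ^ (κ - 2) := by
    rw [hpow]; gcongr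
  calc a ^ κ * b ^ κ ≤ a * b * R ^ (κ - 2) * b ^ κ := by gcongr
    _ ≤ _ := by
      gcongr
      linarith [pow_nonneg ha κ]

/-- Inverse phase estimate: in the non-resonant regime,
`|ξ₁|^κ |ξ₁+2εξ₂|^κ ≤ C |ε^κ(P(ξ₁/ε+ξ₂) − P(ξ₂))| (|ξ₁|^κ + |ξ₁+2εξ₂|^κ)`,
i.e. `1/|Φ| ≤ C ε^{κ−α}(|ξ₁|^{−κ} + |ξ₁+2εξ₂|^{−κ})` whenever `Φ ≠ 0`. -/
theorem inverse_phase_bound (κ : ℕ) (hκ : 2 ≤ κ) (d : ℕ → ℝ) (hd : d κ = 1) :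
    ∃ C₀ : ℝ, 1 ≤ C₀ ∧ ∃ C : ℝ, 0 < C ∧
      ∀ ε : ℝ, 0 < ε → ∀ ξ₁ ξ₂ : ℝ,
        (C₀ * ε ≤ |ξ₁| ∨ C₀ * ε ≤ |ξ₁ + 2 * ε * ξ₂|) →
        |ξ₁| ^ κ * |ξ₁ + 2 * ε * ξ₂| ^ κ ≤
          C * |ε ^ κ * (P κ d (ξ₁ / ε + ξ₂) - P κ d ξ₂)| *
            (|ξ₁| ^ κ + |ξ₁ + 2 * ε * ξ₂| ^ κ) := by
  obtain ⟨R₀, hR₀, hP⟩ := exists_le_abs_P_sub_P κ hκ d hd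
  refine ⟨2 * R₀, by linarith, 8, by norm_num, fun ε hε ξ₁ ξ₂ h => ?_⟩
  obtain ⟨a, rfl⟩ : ∃ a, ξ₁ = ε * a := ⟨ξ₁ / ε, by field_simp⟩
  rw [mul_div_cancel_left₀ _ hε.ne', show ε * a + 2 * ε * ξ₂ = ε * (a + 2 * ξ₂) by ring] at *
  simp only [abs_mul, abs_of_pos hε, abs_of_pos (pow_pos hε κ), mul_pow] at h ⊢
  have hsub : a + ξ₂ - ξ₂ = a := by ring
  have hadd : a + ξ₂ + ξ₂ = a + 2 * ξ₂ := by ring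
  have hl := le_max_left |a + ξ₂| |ξ₂|
  have hr := le_max_right |a + ξ₂| |ξ₂|
  have hsum : |a| + |a + 2 * ξ₂| ≤ 2 * max |a + ξ₂| |ξ₂| := by
    rcases abs_cases a with ⟨h1, _⟩ | ⟨h1, _⟩ <;>
    rcases abs_cases (a + 2 * ξ₂) with ⟨h2, _⟩ | ⟨h2, _⟩ <;>
    linarith [le_abs_self (a + ξ₂), neg_le_abs (a + ξ₂), le_abs_self ξ₂, neg_le_abs ξ₂]
  have hlarge : R₀ ≤ max |a + ξ₂| |ξ₂| := by
    rcases h with h | h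
    · have : 2 * R₀ ≤ |a| := le_of_mul_le_mul_left (by linarith) hε
      linarith [abs_nonneg a, abs_nonneg (a + 2 * ξ₂)]
    · have : 2 * R₀ ≤ |a + 2 * ξ₂| := le_of_mul_le_mul_left (by linarith) hε
      linarith [abs_nonneg a, abs_nonneg (a + 2 * ξ₂)]
  have hphase := hP (a + ξ₂) ξ₂ hlarge
  rw [hsub, hadd] at hphase
  have hcore : |a| ^ κ * |a + 2 * ξ₂| ^ κ ≤
      8 * |P κ d (a + ξ₂) - P κ d ξ₂| * (|a| ^ κ + |a + 2 * ξ₂| ^ κ) :=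
    (pow_mul_pow_le_mul_add (abs_nonneg a) (abs_nonneg _) hsum hκ).trans (by gcongr)
  calc _ = ε ^ κ * ε ^ κ * (|a| ^ κ * |a + 2 * ξ₂| ^ κ) := by ring
    _ ≤ ε ^ κ * ε ^ κ *
        (8 * |P κ d (a + ξ₂) - P κ d ξ₂| * (|a| ^ κ + |a + 2 * ξ₂| ^ κ)) := by gcongr
    _ = _ := by ring
end

section
/- Assume κ is odd. There exist constants C₀ ≥ 1 and c > 0, depending only on κ and the coefficients d_{κ−2j}, such that for every ε > 0 and all ξ₁, ξ₂ ∈ ℝ with |ξ₁| ≥ C₀ε, one has |ε^κ (P(ξ₁/ε + ξ₂) − P(ξ₂))| ≥ c |ξ₁|^κ; equivalently, for the phase Φ(ξ₁,ξ₂) := ε^α(P(ξ₁/ε + ξ₂) − P(ξ₂)) one has 1/|Φ(ξ₁,ξ₂)| ≤ C ε^{κ−α}/|ξ₁|^κ for some C depending only on κ and the coefficients. -/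
open MeasureTheory Real
open scoped ENNReal NNReal

/-- For an odd exponent, `a ^ (2n+1) - b ^ (2n+1)` dominates `(a - b) * max |a| |b| ^ (2n) / 2`. -/
lemma abs_sub_mul_max_pow_le_abs_odd_pow_sub (n : ℕ) (a b : ℝ) :
    1 / 2 * (max |a| |b| ^ (2 * n) * |a - b|) ≤ |a ^ (2 * n + 1) - b ^ (2 * n + 1)| := by
  have hmax : max |a| |b| ^ (2 * n) ≤ a ^ (2 * n) + b ^ (2 * n) := by
    have ha : 0 ≤ a ^ (2 * n) := (even_two_mul n).pow_nonneg a
    have hb : 0 ≤ b ^ (2 * n) := (even_two_mul n).pow_nonneg b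
    rcases max_choice |a| |b| with h | h <;> rw [h, (even_two_mul n).pow_abs] <;> linarith
  have hsign : 0 ≤ (a ^ 2 - b ^ 2) * (a ^ (2 * n) - b ^ (2 * n)) := by
    rw [pow_mul, pow_mul]
    rcases le_total (a ^ 2) (b ^ 2) with h | h
    · exact mul_nonneg_of_nonpos_of_nonpos (sub_nonpos.2 h)
        (sub_nonpos.2 (pow_le_pow_left₀ (sq_nonneg a) h n))
    · exact mul_nonneg (sub_nonneg.2 h)
        (sub_nonneg.2 (pow_le_pow_left₀ (sq_nonneg b) h n))
  rcases eq_or_ne a b with rfl | hab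
  · simp
  have hpos : 0 < |a - b| := abs_pos.2 (sub_ne_zero.2 hab)
  refine le_of_mul_le_mul_left ?_ hpos
  rw [← abs_mul]
  refine le_trans ?_ (le_abs_self _)
  have hsq : |a - b| * |a - b| = (a - b) * (a - b) := abs_mul_abs_self _
  calc |a - b| * (1 / 2 * (max |a| |b| ^ (2 * n) * |a - b|))
      = 1 / 2 * (max |a| |b| ^ (2 * n) * ((a - b) * (a - b))) := by rw [← hsq]; ring
    _ ≤ 1 / 2 * ((a ^ (2 * n) + b ^ (2 * n)) * ((a - b) * (a - b))) := by
        have := mul_le_mul_of_nonneg_right hmax (mul_self_nonneg (a - b))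
        linarith
    _ ≤ 1 / 2 * ((a ^ (2 * n) + b ^ (2 * n)) * ((a - b) * (a - b)))
          + 1 / 2 * ((a ^ 2 - b ^ 2) * (a ^ (2 * n) - b ^ (2 * n))) := by linarith
    _ = (a - b) * (a ^ (2 * n + 1) - b ^ (2 * n + 1)) := by ring

/-- The increments of an odd dispersion symbol of degree `2n+1` over long intervals are bounded
below by the corresponding power of the length. -/
lemma exists_mul_abs_sub_pow_le_abs_P_sub (n : ℕ) (d : ℕ → ℝ) (hd : d (2 * n + 1) = 1) :
    ∃ C₀ : ℝ, 1 ≤ C₀ ∧ ∃ c : ℝ, 0 < c ∧ ∀ a b : ℝ, C₀ ≤ |a - b| →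
      c * |a - b| ^ (2 * n + 1) ≤ |P (2 * n + 1) d a - P (2 * n + 1) d b| := by
  set A : ℝ := ∑ j ∈ Finset.range n, |d (2 * n + 1 - 2 * (j + 1))| * (2 * n + 1) with hA
  have hA0 : 0 ≤ A := Finset.sum_nonneg fun j _ => by positivity
  refine ⟨2 + 8 * A, by linarith, 1 / 4 * (1 / 2) ^ (2 * n), by positivity, fun a b hab => ?_⟩
  set M : ℝ := max |a| |b| with hM
  have hM2 : |a - b| / 2 ≤ M := by
    have := abs_sub a b
    have := le_max_left |a| |b|
    have := le_max_right |a| |b|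
    linarith
  have hM1 : 1 + 4 * A ≤ M := by linarith
  have hMone : 1 ≤ M := by linarith
  have hexp : (2 * n + 1 + 1) / 2 = n + 1 := by omega
  have hsplit : P (2 * n + 1) d a - P (2 * n + 1) d b =
      (a ^ (2 * n + 1) - b ^ (2 * n + 1)) + ∑ j ∈ Finset.range n,
        d (2 * n + 1 - 2 * (j + 1)) *
          (a ^ (2 * n + 1 - 2 * (j + 1)) - b ^ (2 * n + 1 - 2 * (j + 1))) := by
    simp only [P, hexp, Finset.sum_range_succ', mul_sub, Finset.sum_sub_distrib]
    simp only [mul_zero, Nat.sub_zero, hd]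
    ring
  have hlow : |∑ j ∈ Finset.range n, d (2 * n + 1 - 2 * (j + 1)) *
      (a ^ (2 * n + 1 - 2 * (j + 1)) - b ^ (2 * n + 1 - 2 * (j + 1)))| ≤
      1 / 4 * (M ^ (2 * n) * |a - b|) := by
    have hterm : ∀ j ∈ Finset.range n, |d (2 * n + 1 - 2 * (j + 1)) *
        (a ^ (2 * n + 1 - 2 * (j + 1)) - b ^ (2 * n + 1 - 2 * (j + 1)))| * M ≤
        |d (2 * n + 1 - 2 * (j + 1))| * (2 * n + 1) * (M ^ (2 * n) * |a - b|) := by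
      intro j hj
      have hjn := Finset.mem_range.1 hj
      set m := 2 * n + 1 - 2 * (j + 1) with hm
      have hmn : (m : ℝ) ≤ 2 * n + 1 := by
        have : m ≤ 2 * n + 1 := by omega
        exact_mod_cast this
      have hpow : M ^ (m - 1) * M ≤ M ^ (2 * n) := by
        rw [← pow_succ]
        exact pow_le_pow_right₀ hMone (by omega)
      calc |d m * (a ^ m - b ^ m)| * M
          ≤ |d m| * (|a - b| * m * M ^ (m - 1)) * M := by
            rw [abs_mul]
            have := abs_pow_sub_pow_le a b m
            gcongr
        _ = |d m| * m * ((M ^ (m - 1) * M) * |a - b|) := by ring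
        _ ≤ |d m| * (2 * n + 1) * (M ^ (2 * n) * |a - b|) := by gcongr
    have hsum := Finset.sum_le_sum hterm
    rw [← Finset.sum_mul, ← Finset.sum_mul, ← hA] at hsum
    refine (Finset.abs_sum_le_sum_abs _ _).trans ?_
    refine le_of_mul_le_mul_right (hsum.trans ?_) (by linarith : 0 < M)
    have hX : 0 ≤ M ^ (2 * n) * |a - b| := by positivity
    have := mul_le_mul_of_nonneg_right (by linarith : A ≤ 1 / 4 * M) hX
    linarith
  have htop := abs_sub_mul_max_pow_le_abs_odd_pow_sub n a b
  rw [← hM] at htop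
  have hfinal : 1 / 4 * (1 / 2) ^ (2 * n) * |a - b| ^ (2 * n + 1) ≤
      1 / 4 * (M ^ (2 * n) * |a - b|) := by
    calc 1 / 4 * (1 / 2) ^ (2 * n) * |a - b| ^ (2 * n + 1)
        = 1 / 4 * ((|a - b| / 2) ^ (2 * n) * |a - b|) := by
          rw [div_eq_mul_inv |a - b|, mul_pow, pow_succ |a - b|, one_div (2 : ℝ)]; ring
      _ ≤ 1 / 4 * (M ^ (2 * n) * |a - b|) := by gcongr
  rw [hsplit]
  have htri := abs_sub_abs_le_abs_add (a ^ (2 * n + 1) - b ^ (2 * n + 1))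
    (∑ j ∈ Finset.range n, d (2 * n + 1 - 2 * (j + 1)) *
      (a ^ (2 * n + 1 - 2 * (j + 1)) - b ^ (2 * n + 1 - 2 * (j + 1))))
  linarith

/-- For odd `κ`, the rescaled phase is bounded below by `c |ξ₁|^κ` whenever
`|ξ₁| ≥ C₀ε`; equivalently `1/|Φ| ≤ C ε^{κ−α}/|ξ₁|^κ`. -/
theorem phase_lower_bound_odd (κ : ℕ) (hκ : 2 ≤ κ) (hodd : Odd κ)
    (d : ℕ → ℝ) (hd : d κ = 1) :
    ∃ C₀ : ℝ, 1 ≤ C₀ ∧ ∃ c : ℝ, 0 < c ∧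
      ∀ ε : ℝ, 0 < ε → ∀ ξ₁ ξ₂ : ℝ, C₀ * ε ≤ |ξ₁| →
        c * |ξ₁| ^ κ ≤ |ε ^ κ * (P κ d (ξ₁ / ε + ξ₂) - P κ d ξ₂)| := by
  obtain ⟨n, rfl⟩ := hodd
  obtain ⟨C₀, hC₀, c, hc, h⟩ := exists_mul_abs_sub_pow_le_abs_P_sub n d hd
  refine ⟨C₀, hC₀, c, hc, fun ε hε ξ₁ ξ₂ hξ => ?_⟩
  have hdiff : |ξ₁ / ε + ξ₂ - ξ₂| = |ξ₁| / ε := by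
    rw [add_sub_cancel_right, abs_div, abs_of_pos hε]
  have hbound := h (ξ₁ / ε + ξ₂) ξ₂ (by rwa [hdiff, le_div_iff₀ hε])
  rw [hdiff] at hbound
  rw [abs_mul, abs_of_pos (pow_pos hε _)]
  calc c * |ξ₁| ^ (2 * n + 1) = ε ^ (2 * n + 1) * (c * (|ξ₁| / ε) ^ (2 * n + 1)) := by
        rw [div_pow]
        field_simp
    _ ≤ _ := mul_le_mul_of_nonneg_left hbound (pow_pos hε _).le
end

section
/- There exist constants C₀ ≥ 1 and C > 0, depending only on κ and the coefficients d_{κ−2j}, such that for every ε > 0, every integer j with 0 ≤ j ≤ κ, and all ξ₁, ξ₂ ∈ ℝ with |ξ₁ + 2εξ₂| ≥ C₀ε, setting ξ := ξ₁/ε + ξ₂, one has ε^j · |ξ^j − ξ₂^j| · |ξ₁ + 2εξ₂|^{κ−j} ≤ C · |ε^κ (P(ξ₁/ε + ξ₂) − P(ξ₂))|; equivalently, whenever the phase Φ(ξ₁,ξ₂) := ε^α(P(ξ) − P(ξ₂)) is nonzero, |ξ^j − ξ₂^j|/|Φ(ξ₁,ξ₂)| ≤ C ε^{κ−j−α}/|ξ₁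 + 2εξ₂|^{κ−j}. -/
open MeasureTheory Real
open scoped ENNReal NNReal

/-- Homogeneous comparison of power differences, for `x` dominating `y`. -/
lemma abs_pow_sub_pow_mul_le_of_nonneg {n j : ℕ} (hj : j ≤ n) {x y : ℝ} (hx : 0 ≤ x)
    (hyx : |y| ≤ x) :
    |x ^ j - y ^ j| * |x + y| ^ (n - j) ≤ 2 ^ n * |x ^ n - y ^ n| := by
  have one_le : (1 : ℝ) ≤ 2 ^ n := one_le_pow₀ (by norm_num)
  rcases hj.eq_or_lt with rfl | hlt
  · simpa using le_mul_of_one_le_left (abs_nonneg (x ^ j - y ^ j)) one_le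
  have two_le : (2 : ℝ) ≤ 2 ^ n := le_self_pow₀ (by norm_num) (by omega)
  have split : x ^ j * x ^ (n - j) = x ^ n := by rw [← pow_add]; congr 1; omega
  rcases le_total 0 y with hy | hy
  · rw [abs_of_nonneg hy] at hyx
    have hjj : y ^ j ≤ x ^ j := pow_le_pow_left₀ hy hyx j
    have hnn : y ^ n ≤ x ^ n := pow_le_pow_left₀ hy hyx n
    rw [abs_of_nonneg (sub_nonneg.2 hjj), abs_of_nonneg (sub_nonneg.2 hnn),
      abs_of_nonneg (add_nonneg hx hy)]
    have split_y : y ^ j * y ^ (n - j) = y ^ n := by rw [← pow_add]; congr 1; omega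
    have hmix : y ^ n ≤ y ^ j * x ^ (n - j) := by
      rw [← split_y]
      gcongr
    calc (x ^ j - y ^ j) * (x + y) ^ (n - j)
        ≤ (x ^ j - y ^ j) * (2 * x) ^ (n - j) := by
          have := sub_nonneg.2 hjj
          gcongr
          linarith
      _ = 2 ^ (n - j) * ((x ^ j - y ^ j) * x ^ (n - j)) := by rw [mul_pow]; ring
      _ ≤ 2 ^ (n - j) * (x ^ n - y ^ n) := by
          gcongr
          rw [sub_mul, split]
          linarith
      _ ≤ 2 ^ n * (x ^ n - y ^ n) := by
          have := sub_nonneg.2 hnn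
          gcongr
          · norm_num
          · omega
  · obtain ⟨t, rfl⟩ : ∃ t, y = -t := ⟨-y, by ring⟩
    have ht : 0 ≤ t := by linarith
    rw [abs_neg, abs_of_nonneg ht] at hyx
    have hdiff : |x ^ j - (-t) ^ j| ≤ 2 * x ^ j := by
      have h1 : |(-t) ^ j| ≤ x ^ j := by
        rw [abs_pow, abs_neg, abs_of_nonneg ht]
        exact pow_le_pow_left₀ ht hyx j
      have h2 : |x ^ j| = x ^ j := abs_of_nonneg (pow_nonneg hx j)
      linarith [abs_sub (x ^ j) ((-t) ^ j)]
    have hxt : 0 ≤ x + -t := by linarith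
    have hxt_le : x + -t ≤ x := by linarith
    rw [abs_of_nonneg hxt]
    rcases n.even_or_odd with he | ho
    · have hnn : t ^ n ≤ x ^ n := pow_le_pow_left₀ ht hyx n
      rw [he.neg_pow, abs_of_nonneg (sub_nonneg.2 hnn)]
      have hpow : (x + -t) ^ (n - j) ≤ x ^ (n - j - 1) * (x + -t) := by
        rw [show n - j = n - j - 1 + 1 by omega, pow_succ, Nat.add_sub_cancel]
        gcongr
      have hlow : x ^ (n - 1) * (x + -t) ≤ x ^ n - t ^ n := by
        have h1 : t ^ (n - 1) ≤ x ^ (n - 1) := pow_le_pow_left₀ ht hyx _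
        have h2 : x ^ n = x ^ (n - 1) * x := by rw [← pow_succ]; congr 1; omega
        have h3 : t ^ n = t ^ (n - 1) * t := by rw [← pow_succ]; congr 1; omega
        rw [h2, h3]
        linarith [mul_le_mul_of_nonneg_right h1 ht]
      calc |x ^ j - (-t) ^ j| * (x + -t) ^ (n - j)
          ≤ (2 * x ^ j) * (x ^ (n - j - 1) * (x + -t)) := by gcongr
        _ = 2 * (x ^ (n - 1) * (x + -t)) := by
            rw [show n - 1 = j + (n - j - 1) by omega, pow_add]; ring
        _ ≤ 2 ^ n * (x ^ n - t ^ n) := by gcongr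
    · rw [ho.neg_pow, sub_neg_eq_add,
        abs_of_nonneg (add_nonneg (pow_nonneg hx n) (pow_nonneg ht n))]
      calc |x ^ j - (-t) ^ j| * (x + -t) ^ (n - j)
          ≤ (2 * x ^ j) * x ^ (n - j) := by gcongr
        _ = 2 * x ^ n := by rw [mul_assoc, split]
        _ ≤ 2 ^ n * (x ^ n + t ^ n) := by
            gcongr
            exact le_add_of_nonneg_right (pow_nonneg ht n)

/-- Homogeneous comparison of the differences of `j`-th and `n`-th powers, `j ≤ n`. -/
lemma abs_pow_sub_pow_mul_le {n j : ℕ} (hj : j ≤ n) (x y : ℝ) :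
    |x ^ j - y ^ j| * |x + y| ^ (n - j) ≤ 2 ^ n * |x ^ n - y ^ n| := by
  wlog hyx : |y| ≤ |x| generalizing x y
  · have := this y x (le_of_not_ge hyx)
    rwa [abs_sub_comm (y ^ j), abs_sub_comm (y ^ n), add_comm y] at this
  rcases le_total 0 x with hx | hx
  · exact abs_pow_sub_pow_mul_le_of_nonneg hj hx (by rwa [abs_of_nonneg hx] at hyx)
  · have hneg (m : ℕ) : |(-x) ^ m - (-y) ^ m| = |x ^ m - y ^ m| := by
      rw [neg_pow x, neg_pow y, ← mul_sub, abs_mul, abs_pow, abs_neg, abs_one, one_pow, one_mul]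
    have := abs_pow_sub_pow_mul_le_of_nonneg hj (x := -x) (y := -y) (by linarith)
      (by rwa [abs_neg, ← abs_of_nonpos hx])
    rwa [hneg, hneg, ← neg_add, abs_neg] at this

/-- Away from `x + y = 0`, the leading power controls the difference of the symbol. -/
lemma abs_pow_sub_pow_le_two_mul_abs_P_sub {κ : ℕ} (hκ : 2 ≤ κ) {d : ℕ → ℝ} (hd : d κ = 1)
    {x y : ℝ}
    (hxy : 1 + 2 * (2 ^ κ * ∑ i ∈ Finset.range ((κ + 1) / 2 - 1), |d (κ - 2 * (i + 1))|)
      ≤ |x + y|) :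
    |x ^ κ - y ^ κ| ≤ 2 * |P κ d x - P κ d y| := by
  set S := ∑ i ∈ Finset.range ((κ + 1) / 2 - 1), |d (κ - 2 * (i + 1))|
  set w := |x ^ κ - y ^ κ|
  have hw0 : 0 ≤ w := abs_nonneg _
  have hS0 : 0 ≤ S := Finset.sum_nonneg fun _ _ => abs_nonneg _
  have hS1 : 0 ≤ 2 ^ κ * S := by positivity
  have hs1 : 1 ≤ |x + y| := by linarith
  have hdec : P κ d x - P κ d y = (x ^ κ - y ^ κ) +
      ∑ i ∈ Finset.range ((κ + 1) / 2 - 1),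
        d (κ - 2 * (i + 1)) * (x ^ (κ - 2 * (i + 1)) - y ^ (κ - 2 * (i + 1))) := by
    unfold P
    rw [← Finset.sum_sub_distrib, show (κ + 1) / 2 = (κ + 1) / 2 - 1 + 1 by omega,
      Finset.sum_range_succ']
    simp [hd, mul_sub, add_comm]
  set R := ∑ i ∈ Finset.range ((κ + 1) / 2 - 1),
        d (κ - 2 * (i + 1)) * (x ^ (κ - 2 * (i + 1)) - y ^ (κ - 2 * (i + 1))) with hR
  have hRle : |R| * |x + y| ≤ 2 ^ κ * S * w := by
    calc |R| * |x + y|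
        ≤ (∑ i ∈ Finset.range ((κ + 1) / 2 - 1), |d (κ - 2 * (i + 1))| *
            |x ^ (κ - 2 * (i + 1)) - y ^ (κ - 2 * (i + 1))|) * |x + y| := by
          gcongr
          rw [hR]
          refine (Finset.abs_sum_le_sum_abs _ _).trans_eq ?_
          simp only [abs_mul]
      _ = ∑ i ∈ Finset.range ((κ + 1) / 2 - 1), |d (κ - 2 * (i + 1))| *
            (|x ^ (κ - 2 * (i + 1)) - y ^ (κ - 2 * (i + 1))| * |x + y|) := by
          rw [Finset.sum_mul]
          exact Finset.sum_congr rfl fun _ _ => mul_assoc _ _ _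
      _ ≤ ∑ i ∈ Finset.range ((κ + 1) / 2 - 1), |d (κ - 2 * (i + 1))| * (2 ^ κ * w) := by
          refine Finset.sum_le_sum fun i _ => mul_le_mul_of_nonneg_left ?_ (abs_nonneg _)
          refine le_trans (mul_le_mul_of_nonneg_left ?_ (abs_nonneg _))
            (abs_pow_sub_pow_mul_le (Nat.sub_le κ (2 * (i + 1))) x y)
          exact le_self_pow₀ hs1 (by omega)
      _ = 2 ^ κ * S * w := by rw [← Finset.sum_mul]; ring
  have hRw : 2 * |R| ≤ w := by
    refine le_of_mul_le_mul_right ?_ (by linarith : 0 < |x + y|)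
    have : (1 + 2 * (2 ^ κ * S)) * w ≤ |x + y| * w := mul_le_mul_of_nonneg_right hxy hw0
    linarith
  have htri : w ≤ |P κ d x - P κ d y| + |R| := by
    have := abs_sub (P κ d x - P κ d y) R
    rwa [hdec, add_sub_cancel_right, ← hdec] at this
  linarith

/-- Non-resonant estimate for the frequency difference divided by the phase:
if `|ξ₁ + 2εξ₂| ≥ C₀ε` then, with `ξ = ξ₁/ε + ξ₂`,
`ε^j |ξ^j − ξ₂^j| |ξ₁+2εξ₂|^{κ−j} ≤ C |ε^κ(P(ξ) − P(ξ₂))|` for `0 ≤ j ≤ κ`;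
equivalently `|ξ^j − ξ₂^j|/|Φ| ≤ C ε^{κ−j−α}/|ξ₁+2εξ₂|^{κ−j}`. -/
theorem freq_difference_nonresonant (κ : ℕ) (hκ : 2 ≤ κ) (d : ℕ → ℝ) (hd : d κ = 1) :
    ∃ C₀ : ℝ, 1 ≤ C₀ ∧ ∃ C : ℝ, 0 < C ∧
      ∀ ε : ℝ, 0 < ε → ∀ j : ℕ, j ≤ κ →
        ∀ ξ₁ ξ₂ : ℝ, C₀ * ε ≤ |ξ₁ + 2 * ε * ξ₂| →
          ε ^ j * |(ξ₁ / ε + ξ₂) ^ j - ξ₂ ^ j| * |ξ₁ + 2 * ε * ξ₂| ^ (κ - j) ≤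
            C * |ε ^ κ * (P κ d (ξ₁ / ε + ξ₂) - P κ d ξ₂)| := by
  set S := ∑ i ∈ Finset.range ((κ + 1) / 2 - 1), |d (κ - 2 * (i + 1))|
  have hS0 : 0 ≤ S := Finset.sum_nonneg fun _ _ => abs_nonneg _
  refine ⟨1 + 2 * (2 ^ κ * S), le_add_of_nonneg_right (by positivity), 2 ^ κ * 2, by positivity,
    fun ε hε j hj ξ₁ ξ₂ h => ?_⟩
  set x := ξ₁ / ε + ξ₂ with hx
  have hsum : ξ₁ + 2 * ε * ξ₂ = ε * (x + ξ₂) := by rw [hx]; field_simp; ring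
  rw [hsum, abs_mul, abs_of_pos hε] at h ⊢
  have hlarge : 1 + 2 * (2 ^ κ * S) ≤ |x + ξ₂| :=
    le_of_mul_le_mul_left (by rwa [mul_comm] at h) hε
  have hεκ : ε ^ j * ε ^ (κ - j) = ε ^ κ := by rw [← pow_add]; congr 1; omega
  calc ε ^ j * |x ^ j - ξ₂ ^ j| * (ε * |x + ξ₂|) ^ (κ - j)
      = ε ^ κ * (|x ^ j - ξ₂ ^ j| * |x + ξ₂| ^ (κ - j)) := by rw [mul_pow, ← hεκ]; ring
    _ ≤ ε ^ κ * (2 ^ κ * (2 * |P κ d x - P κ d ξ₂|)) := by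
        refine mul_le_mul_of_nonneg_left ?_ (pow_pos hε κ).le
        refine (abs_pow_sub_pow_mul_le hj x ξ₂).trans ?_
        gcongr
        exact abs_pow_sub_pow_le_two_mul_abs_P_sub hκ hd hlarge
    _ = 2 ^ κ * 2 * |ε ^ κ * (P κ d x - P κ d ξ₂)| := by
        rw [abs_mul, abs_of_pos (pow_pos hε κ)]; ring
end

section
/- Define g_ε(y) := Σ_{0 ≤ 2j < κ} ε^{2j} (d_{κ−2j}/2^{κ−2j−1}) (κ−2j) y^{κ−2j}. There exist constants C₀' ≥ 1 and c > 0, depending only on κ and the coefficients d_{κ−2j}, such that for every ε > 0 and all real numbers x, y with C₀'ε ≤ x ≤ y, one has g_ε(y) − g_ε(x) ≥ c (y^κ − x^κ). -/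
open MeasureTheory Real
open scoped ENNReal NNReal

/-- The polynomial `g_ε(y) = Σ_{0 ≤ 2j < κ} ε^{2j} (d_{κ−2j}/2^{κ−2j−1}) (κ−2j) y^{κ−2j}`. -/
noncomputable def g (κ : ℕ) (d : ℕ → ℝ) (ε y : ℝ) : ℝ :=
  ∑ j ∈ Finset.range ((κ + 1) / 2),
    ε ^ (2 * j) * (d (κ - 2 * j) / 2 ^ (κ - 2 * j - 1)) * ((κ - 2 * j : ℕ) : ℝ) *
      y ^ (κ - 2 * j)

/-- A lower-order monomial increment, weighted by the complementary power of `ε`, is dominated by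
the top-order increment, with a gain `C` when `x ≥ C * ε`. -/
theorem mul_pow_mul_pow_sub_pow_le {C ε x y : ℝ} (hC : 1 ≤ C) (hε : 0 ≤ ε) (hx : C * ε ≤ x)
    (hxy : x ≤ y) {k : ℕ} (hk : k ≠ 0) (m : ℕ) :
    C * (ε ^ k * (y ^ m - x ^ m)) ≤ y ^ (k + m) - x ^ (k + m) := by
  have hx0 : 0 ≤ x := le_trans (by positivity) hx
  have hm : 0 ≤ y ^ m - x ^ m := sub_nonneg.2 (by gcongr)
  have hCk : C * ε ^ k ≤ x ^ k :=
    calc C * ε ^ k ≤ C ^ k * ε ^ k := by gcongr; exact le_self_pow₀ hC hk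
      _ = (C * ε) ^ k := (mul_pow _ _ _).symm
      _ ≤ x ^ k := by gcongr
  have hxk : x ^ k ≤ y ^ k := by gcongr
  calc C * (ε ^ k * (y ^ m - x ^ m)) = C * ε ^ k * (y ^ m - x ^ m) := by ring
    _ ≤ x ^ k * (y ^ m - x ^ m) := by gcongr
    _ = x ^ k * y ^ m - x ^ (k + m) := by ring
    _ ≤ y ^ k * y ^ m - x ^ (k + m) := by
      have : 0 ≤ y ^ m := pow_nonneg (hx0.trans hxy) m
      gcongr
    _ = y ^ (k + m) - x ^ (k + m) := by ring

/-- Monotonicity of `g_ε` away from the origin: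
`g_ε(y) − g_ε(x) ≥ c (y^κ − x^κ)` whenever `C₀'ε ≤ x ≤ y`. -/
theorem g_growth (κ : ℕ) (hκ : 2 ≤ κ) (d : ℕ → ℝ) (hd : d κ = 1) :
    ∃ C₀' : ℝ, 1 ≤ C₀' ∧ ∃ c : ℝ, 0 < c ∧
      ∀ ε : ℝ, 0 < ε → ∀ x y : ℝ, C₀' * ε ≤ x → x ≤ y →
        c * (y ^ κ - x ^ κ) ≤ g κ d ε y - g κ d ε x := by
  obtain ⟨n, hn⟩ : ∃ n, (κ + 1) / 2 = n + 1 := ⟨(κ + 1) / 2 - 1, by omega⟩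
  set a : ℕ → ℝ := fun j => d (κ - 2 * j) / 2 ^ (κ - 2 * j - 1) * ((κ - 2 * j : ℕ) : ℝ) with ha
  set S : ℝ := ∑ j ∈ Finset.range n, |a (j + 1)| with hS
  have hS0 : 0 ≤ S := Finset.sum_nonneg fun _ _ => abs_nonneg _
  set c : ℝ := a 0 / 2 with hc
  have hc0 : 0 < c := by
    have : (0 : ℝ) < κ := by exact_mod_cast (by omega : 0 < κ)
    simp only [hc, ha, mul_zero, Nat.sub_zero, hd]
    positivity
  have hC : 1 ≤ 1 + S / c := le_add_of_nonneg_right (by positivity)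
  refine ⟨1 + S / c, hC, c, hc0, fun ε hε x y hx hxy => ?_⟩
  set C : ℝ := 1 + S / c with hCdef
  have hC0 : 0 < C := by linarith
  have hSC : S ≤ c * C := by
    have : c * C = c + S := by rw [hCdef]; field_simp
    linarith
  have hx0 : 0 ≤ x := le_trans (by positivity) hx
  have hΔ : 0 ≤ y ^ κ - x ^ κ := sub_nonneg.2 (by gcongr)
  have hg : g κ d ε y - g κ d ε x = a 0 * (y ^ κ - x ^ κ) +
      ∑ j ∈ Finset.range n, a (j + 1) *
        (ε ^ (2 * (j + 1)) * (y ^ (κ - 2 * (j + 1)) - x ^ (κ - 2 * (j + 1)))) := by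
    rw [g, g, hn, ← Finset.sum_sub_distrib, Finset.sum_range_succ', add_comm]
    congr 1
    · simp only [ha, mul_zero, Nat.sub_zero, pow_zero]
      ring
    · refine Finset.sum_congr rfl fun j _ => ?_
      simp only [ha]
      ring
  have hterm : ∀ j ∈ Finset.range n, -(|a (j + 1)| * ((y ^ κ - x ^ κ) / C)) ≤ a (j + 1) *
      (ε ^ (2 * (j + 1)) * (y ^ (κ - 2 * (j + 1)) - x ^ (κ - 2 * (j + 1)))) := by
    intro j hj
    have hj' := Finset.mem_range.1 hj
    have key := mul_pow_mul_pow_sub_pow_le hC hε.le hx hxy (k := 2 * (j + 1)) (by omega)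
      (κ - 2 * (j + 1))
    rw [show 2 * (j + 1) + (κ - 2 * (j + 1)) = κ by omega, mul_comm C, ← le_div_iff₀ hC0] at key
    have hT : 0 ≤ ε ^ (2 * (j + 1)) * (y ^ (κ - 2 * (j + 1)) - x ^ (κ - 2 * (j + 1))) :=
      mul_nonneg (by positivity) (sub_nonneg.2 (by gcongr))
    have h1 := mul_le_mul_of_nonneg_left key (abs_nonneg (a (j + 1)))
    have h2 := mul_le_mul_of_nonneg_right (neg_abs_le (a (j + 1))) hT
    linarith
  have hsum := Finset.sum_le_sum hterm
  rw [Finset.sum_neg_distrib, ← Finset.sum_mul, ← hS] at hsum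
  have hbound : S * ((y ^ κ - x ^ κ) / C) ≤ c * (y ^ κ - x ^ κ) := by
    rw [← mul_div_assoc, div_le_iff₀ hC0]
    linarith [mul_le_mul_of_nonneg_right hSC hΔ]
  have ha0 : a 0 = c + c := by rw [hc]; ring
  rw [hg, ha0, add_mul]
  linarith
end

section
/- There exist τ₀ ∈ (0,1) and C > 0, depending only on κ and the coefficients d_{κ−2j}, such that for every measurable h : ℝ → ℂ with h ∈ L¹(ℝ) ∩ L^∞(ℝ) and every real β with 0 < |β| ≤ τ₀, the integral ∫_ℝ |h(ξ)| / |1 + β P(ξ)|^{(κ−1)/κ} dξ (a value in [0,∞], with the integrand interpreted as +∞ where 1 + βP(ξ) = 0) satisfies ∫_ℝ |h(ξ)| / |1 + β P(ξ)|^{(κ−1)/κ} dξ ≤ C (‖h‖_{L¹} + ‖h‖_{L^∞}) · |β|^{−(κ−1)/κ²}. -/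
open MeasureTheory Real
open scoped ENNReal NNReal

theorem P_neg (κ : ℕ) (d : ℕ → ℝ) (y : ℝ) : P κ d (-y) = (-1) ^ κ * P κ d y := by
  unfold P
  rw [Finset.mul_sum]
  refine Finset.sum_congr rfl fun j hj => ?_
  have hj : 2 * j ≤ κ := by have := Finset.mem_range.1 hj; omega
  have h1 : (-1 : ℝ) ^ κ = (-1) ^ (κ - 2 * j) := by
    conv_lhs => rw [← Nat.sub_add_cancel hj, pow_add, pow_mul]
    simp
  rw [h1, neg_pow y]
  ring

theorem abs_P_le (κ : ℕ) (d : ℕ → ℝ) {y r : ℝ} (hr : 1 ≤ r) (hy : |y| ≤ r) :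
    |P κ d y| ≤ (∑ j ∈ Finset.range ((κ + 1) / 2), |d (κ - 2 * j)|) * r ^ κ := by
  unfold P
  rw [Finset.sum_mul]
  refine (Finset.abs_sum_le_sum_abs _ _).trans (Finset.sum_le_sum fun j _ => ?_)
  rw [abs_mul, abs_pow]
  gcongr
  calc |y| ^ (κ - 2 * j) ≤ r ^ (κ - 2 * j) := by gcongr
    _ ≤ r ^ κ := pow_le_pow_right₀ hr (Nat.sub_le _ _)

theorem pow_sub_pow_le_mul {x y : ℝ} (hy : 0 ≤ y) (hyx : y ≤ x) (k : ℕ) :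
    x ^ k - y ^ k ≤ k * x ^ (k - 1) * (x - y) := by
  rw [← geom_sum₂_mul]
  refine mul_le_mul_of_nonneg_right ?_ (sub_nonneg.2 hyx)
  calc ∑ i ∈ Finset.range k, x ^ i * y ^ (k - 1 - i)
      ≤ ∑ i ∈ Finset.range k, x ^ (k - 1) := by
        refine Finset.sum_le_sum fun i hi => ?_
        have hi := Finset.mem_range.1 hi
        have hx : 0 ≤ x := hy.trans hyx
        calc x ^ i * y ^ (k - 1 - i) ≤ x ^ i * x ^ (k - 1 - i) := by gcongr
          _ = x ^ (k - 1) := by rw [← pow_add]; congr 1; omega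
    _ = k * x ^ (k - 1) := by simp

theorem mul_le_pow_sub_pow {x y : ℝ} (hy : 0 ≤ y) (hyx : y ≤ x) {k : ℕ} (hk : 1 ≤ k) :
    x ^ (k - 1) * (x - y) ≤ x ^ k - y ^ k := by
  obtain ⟨n, rfl⟩ : ∃ n, k = n + 1 := ⟨k - 1, by omega⟩
  have h : y ^ n ≤ x ^ n := by gcongr
  simp only [Nat.add_sub_cancel, pow_succ]
  nlinarith

theorem le_P_sub_P {κ : ℕ} (hκ : 2 ≤ κ) {d : ℕ → ℝ} (hd : d κ = 1) {K x y : ℝ}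
    (hK1 : 1 ≤ K) (hK : ∑ j ∈ Finset.range ((κ + 1) / 2), |d (κ - 2 * j)| ≤ K)
    (hy : 0 ≤ y) (hyx : y ≤ x) (hx : 2 * K * κ ≤ x) :
    x ^ (κ - 1) / 2 * (x - y) ≤ P κ d x - P κ d y := by
  obtain ⟨N, hN⟩ : ∃ N, (κ + 1) / 2 = N + 1 := ⟨(κ + 1) / 2 - 1, by omega⟩
  have hκ' : (2 : ℝ) ≤ κ := by exact_mod_cast hκ
  have hx1 : 1 ≤ x := by nlinarith
  have hxy : 0 ≤ x - y := sub_nonneg.2 hyx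
  unfold P
  rw [hN] at hK ⊢
  rw [← Finset.sum_sub_distrib, Finset.sum_range_succ']
  rw [Finset.sum_range_succ'] at hK
  simp only [mul_zero, Nat.sub_zero, hd, one_mul, abs_one] at hK ⊢
  have hterm : ∀ j ∈ Finset.range N,
      |d (κ - 2 * (j + 1))| * (-(κ * x ^ (κ - 2) * (x - y))) ≤
        d (κ - 2 * (j + 1)) * x ^ (κ - 2 * (j + 1)) -
          d (κ - 2 * (j + 1)) * y ^ (κ - 2 * (j + 1)) := by
    intro j hj
    have hj := Finset.mem_range.1 hj
    set k := κ - 2 * (j + 1) with hk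
    have h0 : 0 ≤ x ^ k - y ^ k := sub_nonneg.2 (by gcongr)
    have h1 : x ^ k - y ^ k ≤ κ * x ^ (κ - 2) * (x - y) := by
      refine (pow_sub_pow_le_mul hy hyx k).trans ?_
      have : x ^ (k - 1) ≤ x ^ (κ - 2) := pow_le_pow_right₀ hx1 (by omega)
      have : (k : ℝ) ≤ κ := by exact_mod_cast (by omega : k ≤ κ)
      gcongr
    rw [← mul_sub]
    have h2 := neg_abs_le (d k)
    have h3 := abs_nonneg (d k)
    nlinarith
  have hsum := Finset.sum_le_sum hterm
  rw [← Finset.sum_mul] at hsum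
  have hmain := mul_le_pow_sub_pow hy hyx (by omega : 1 ≤ κ)
  have hB : 0 ≤ κ * x ^ (κ - 2) * (x - y) := by positivity
  have hK' : ∑ j ∈ Finset.range N, |d (κ - 2 * (j + 1))| ≤ K := by linarith
  have h4 := mul_le_mul_of_nonneg_right hK' hB
  have h5 : K * (κ * x ^ (κ - 2) * (x - y)) ≤ x ^ (κ - 1) / 2 * (x - y) := by
    have : x ^ (κ - 1) = x ^ (κ - 2) * x := by rw [← pow_succ]; congr 1; omega
    rw [this]
    have h6 : 0 ≤ x ^ (κ - 2) * (x - y) := by positivity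
    nlinarith
  linarith

theorem exists_abs_sub_le_of_expanding {f : ℝ → ℝ} (hf : Continuous f) {s : Set ℝ}
    (hs : IsClosed s) (hne : s.Nonempty) {m : ℝ} (hm : 0 < m)
    (hexp : ∀ x ∈ s, ∀ y ∈ s, m * |x - y| ≤ |f x - f y|) :
    ∃ a, ∀ x ∈ s, m * |x - a| ≤ 2 * |f x| := by
  obtain ⟨x₀, hx₀⟩ := hne
  obtain ⟨a, ha, hmin⟩ := hf.abs.continuousOn.exists_isMinOn' hs hx₀ (by
    have hc : (Metric.closedBall x₀ (2 * |f x₀| / m))ᶜ ∈ Filter.cocompact ℝ :=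
      (isCompact_closedBall _ _).compl_mem_cocompact
    filter_upwards [Filter.inter_mem_inf hc (Filter.mem_principal_self s)] with x hx
    have h1 : 2 * |f x₀| / m < |x - x₀| := by
      simpa [Real.dist_eq] using hx.1
    rw [div_lt_iff₀ hm] at h1
    have h2 := hexp x hx.2 x₀ hx₀
    have h3 := abs_sub (f x) (f x₀)
    linarith)
  refine ⟨a, fun x hx => ?_⟩
  have h1 := hexp x hx a ha
  have h2 := abs_sub (f x) (f a)
  have h3 : |f a| ≤ |f x| := hmin hx
  linarith

/-- The kernel `|t| ^ (-s)` truncated to `|t| ≤ 1`, with value `0` at the origin. -/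
noncomputable def truncatedKernel (s t : ℝ) : ℝ :=
  (Set.Ioc (0 : ℝ) 1).indicator (fun u => u ^ (-s)) t +
    (Set.Ioc (0 : ℝ) 1).indicator (fun u => u ^ (-s)) (-t)

theorem truncatedKernel_nonneg (s t : ℝ) : 0 ≤ truncatedKernel s t :=
  add_nonneg (Set.indicator_nonneg (fun _ hu => rpow_nonneg hu.1.le _) _)
    (Set.indicator_nonneg (fun _ hu => rpow_nonneg hu.1.le _) _)

theorem integrable_truncatedKernel {s : ℝ} (hs : s < 1) : Integrable (truncatedKernel s) := by
  have h := intervalIntegral.intervalIntegrable_rpow' (a := 0) (b := 1) (r := -s) (by linarith)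
  rw [intervalIntegrable_iff_integrableOn_Ioc_of_le zero_le_one] at h
  have h' := (integrable_indicator_iff measurableSet_Ioc).2 h
  exact h'.add h'.comp_neg

theorem abs_rpow_neg_le_truncatedKernel {s t : ℝ} (ht : t ≠ 0) (ht1 : |t| ≤ 1) :
    |t| ^ (-s) ≤ truncatedKernel s t := by
  unfold truncatedKernel
  rcases lt_or_gt_of_ne ht with h | h
  · rw [abs_of_neg h] at ht1 ⊢
    rw [Set.indicator_of_notMem (fun hu => by linarith [hu.1]),
      Set.indicator_of_mem (Set.mem_Ioc.2 ⟨by linarith, ht1⟩), zero_add]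
  · rw [abs_of_pos h] at ht1 ⊢
    rw [Set.indicator_of_mem (Set.mem_Ioc.2 ⟨h, ht1⟩), Set.indicator_of_notMem (fun hu => by linarith [hu.1]),
      add_zero]

theorem mul_abs_rpow_neg_le {s t x N : ℝ} (hs : 0 ≤ s) (ht : t ≠ 0) (hx : 0 ≤ x) (hxN : x ≤ N) :
    x * |t| ^ (-s) ≤ x + N * truncatedKernel s t := by
  have hg := truncatedKernel_nonneg s t
  have hN : 0 ≤ N := hx.trans hxN
  rcases le_total |t| 1 with h | h
  · have := abs_rpow_neg_le_truncatedKernel (s := s) ht h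
    have h1 : x * |t| ^ (-s) ≤ N * truncatedKernel s t := by gcongr
    linarith
  · have h1 : |t| ^ (-s) ≤ 1 := rpow_le_one_of_one_le_of_nonpos h (by linarith)
    nlinarith [mul_nonneg hN hg]

theorem exists_lower_bound_one_add_mul_P {κ : ℕ} (hκ : 2 ≤ κ) {d : ℕ → ℝ} (hd : d κ = 1) :
    ∃ τ₀ ∈ Set.Ioo (0 : ℝ) 1, ∃ E : ℝ, 0 < E ∧ ∀ β : ℝ, β ≠ 0 → |β| ≤ τ₀ → ∃ a b : ℝ, ∀ ξ : ℝ,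
      E * |β| ^ (1 / (κ : ℝ)) ≤ |1 + β * P κ d ξ| ∨
      E * |β| ^ (1 / (κ : ℝ)) * |ξ - a| ≤ |1 + β * P κ d ξ| ∨
      E * |β| ^ (1 / (κ : ℝ)) * |ξ - b| ≤ |1 + β * P κ d ξ| := by
  obtain ⟨K, hK1, hK⟩ : ∃ K : ℝ, 1 ≤ K ∧
      ∑ j ∈ Finset.range ((κ + 1) / 2), |d (κ - 2 * j)| ≤ K :=
    ⟨_, le_max_left _ _, le_max_right _ _⟩
  have hκ' : (2 : ℝ) ≤ κ := by exact_mod_cast hκ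
  have hκ0 : κ ≠ 0 := by omega
  set A : ℝ := 1 / (2 * K) with hA
  have hA0 : 0 < A := by positivity
  have hA1 : A ≤ 1 / 2 := by
    rw [hA]; apply one_div_le_one_div_of_le <;> linarith
  have hKA : K * A = 1 / 2 := by rw [hA]; field_simp
  have hM4 : 1 ≤ 2 * K * κ := by nlinarith
  have hM0 : 0 < 2 * K * κ := by linarith
  set δ : ℝ := A / (2 * K * κ) with hδ
  have hδ0 : 0 < δ := by positivity
  have hδ1 : δ < 1 := by rw [hδ, div_lt_one hM0]; linarith
  refine ⟨δ ^ κ, ⟨by positivity, pow_lt_one₀ hδ0.le hδ1 hκ0⟩, A ^ (κ - 1) / 4, by positivity, ?_⟩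
  intro β hβ hβδ
  have hβ0 : 0 < |β| := abs_pos.2 hβ
  set r : ℝ := |β| ^ (1 / (κ : ℝ)) with hr
  have hr0 : 0 < r := rpow_pos_of_pos hβ0 _
  have hrκ : r ^ κ = |β| := by
    rw [hr, one_div]; exact rpow_inv_natCast_pow hβ0.le hκ0
  have hrδ : r ≤ δ := by
    rw [← hrκ] at hβδ
    exact le_of_pow_le_pow_left₀ hκ0 hδ0.le hβδ
  set ρ : ℝ := A / r with hρ
  have hρ0 : 0 < ρ := by positivity
  have hρM : 2 * K * κ ≤ ρ := by
    rw [hδ, le_div_iff₀ hM0] at hrδ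
    rw [hρ, le_div_iff₀ hr0]
    linarith
  have hm : |β| * (ρ ^ (κ - 1) / 2) = r * A ^ (κ - 1) / 2 := by
    rw [← hrκ, hρ, div_pow]
    have : r ^ κ = r ^ (κ - 1) * r := by rw [← pow_succ]; congr 1; omega
    rw [this]
    field_simp
  have hP : ∀ x y, ρ ≤ y → y ≤ x → ρ ^ (κ - 1) / 2 * |x - y| ≤ |P κ d x - P κ d y| := by
    intro x y hy hyx
    have h1 := le_P_sub_P hκ hd hK1 hK (hρ0.le.trans hy) hyx (hρM.trans (hy.trans hyx))
    refine le_trans ?_ (h1.trans (le_abs_self _))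
    have h2 : 0 ≤ x - y := sub_nonneg.2 hyx
    have h3 : ρ ≤ x := hy.trans hyx
    rw [abs_of_nonneg h2]
    gcongr
  have hP' : ∀ x ∈ Set.Ici ρ, ∀ y ∈ Set.Ici ρ,
      ρ ^ (κ - 1) / 2 * |x - y| ≤ |P κ d x - P κ d y| := by
    intro x hx y hy
    rcases le_total y x with h | h
    · exact hP x y hy h
    · rw [abs_sub_comm, abs_sub_comm (P κ d x)]
      exact hP y x hx h
  have hscale : ∀ x y, ρ ^ (κ - 1) / 2 * |x - y| ≤ |P κ d x - P κ d y| →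
      r * A ^ (κ - 1) / 2 * |x - y| ≤ |(1 + β * P κ d x) - (1 + β * P κ d y)| := by
    intro x y h
    rw [add_sub_add_left_eq_sub, ← mul_sub, abs_mul, ← hm, mul_assoc]
    gcongr
  have hcont : Continuous fun x => 1 + β * P κ d x := by unfold P; fun_prop
  have hm0 : 0 < r * A ^ (κ - 1) / 2 := by positivity
  obtain ⟨a, ha⟩ := exists_abs_sub_le_of_expanding hcont isClosed_Ici ⟨ρ, Set.self_mem_Ici⟩ hm0
    fun x hx y hy => hscale x y (hP' x hx y hy)
  obtain ⟨b, hb⟩ := exists_abs_sub_le_of_expanding hcont isClosed_Iic ⟨-ρ, Set.self_mem_Iic⟩ hm0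
    fun x hx y hy => hscale x y (by
      have h := hP' (-x) (Set.mem_Ici.2 (le_neg.1 hx)) (-y) (Set.mem_Ici.2 (le_neg.1 hy))
      rw [P_neg, P_neg, ← mul_sub, abs_mul, abs_pow, abs_neg, abs_one, one_pow, one_mul] at h
      rwa [neg_sub_neg, abs_sub_comm] at h)
  refine ⟨a, b, fun ξ => ?_⟩
  rcases le_total ρ ξ with h | h
  · right; left
    linarith [ha ξ h]
  rcases le_total ξ (-ρ) with h' | h'
  · right; right
    linarith [hb ξ h']
  left
  have h1 : |P κ d ξ| ≤ K * ρ ^ κ :=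
    (abs_P_le κ d (hM4.trans hρM) (abs_le.2 ⟨h', h⟩)).trans (by gcongr)
  have h2 : |β * P κ d ξ| ≤ 1 / 2 := by
    rw [abs_mul]
    calc |β| * |P κ d ξ| ≤ |β| * (K * ρ ^ κ) := by gcongr
      _ = K * A ^ κ := by rw [← hrκ, hρ, div_pow]; field_simp
      _ ≤ K * A := by
        gcongr
        exact pow_le_of_le_one hA0.le (by linarith) hκ0
      _ = 1 / 2 := hKA
  have h3 : 1 / 2 ≤ |1 + β * P κ d ξ| := by
    have := abs_le.1 h2
    exact le_trans (by linarith) (le_abs_self _)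
  have h4 : A ^ (κ - 1) ≤ 1 := pow_le_one₀ hA0.le (by linarith)
  nlinarith [pow_pos hA0 (κ - 1)]

/-- Singular-weight integral bound:
`∫ |h(ξ)|/|1 + βP(ξ)|^{(κ−1)/κ} dξ ≤ C (‖h‖₁ + ‖h‖∞) |β|^{−(κ−1)/κ²}`
for all `0 < |β| ≤ τ₀`; the integrand is `+∞` where `1 + βP(ξ) = 0`
(in the `ℝ≥0∞`-valued convention `a/0 = ∞` for `a ≠ 0`). -/
theorem singular_integral_bound (κ : ℕ) (hκ : 2 ≤ κ) (d : ℕ → ℝ) (hd : d κ = 1) :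
    ∃ τ₀ : ℝ, τ₀ ∈ Set.Ioo (0:ℝ) 1 ∧ ∃ C : ℝ, 0 < C ∧
      ∀ h : ℝ → ℂ, Measurable h → Integrable h → eLpNorm h ⊤ volume ≠ ⊤ →
        ∀ β : ℝ, β ≠ 0 → |β| ≤ τ₀ →
          (∫⁻ ξ : ℝ, ENNReal.ofReal ‖h ξ‖ /
              ENNReal.ofReal (|1 + β * P κ d ξ| ^ (((κ : ℝ) - 1) / κ))) ≤
            ENNReal.ofReal (C * ((∫ ξ : ℝ, ‖h ξ‖) + (eLpNorm h ⊤ volume).toReal) *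
              |β| ^ (-(((κ : ℝ) - 1) / (κ : ℝ) ^ 2))) := by
  obtain ⟨τ₀, hτ₀, E, hE, hlow⟩ := exists_lower_bound_one_add_mul_P hκ hd
  have hκ' : (2 : ℝ) ≤ κ := by exact_mod_cast hκ
  have hκpos : (0 : ℝ) < κ := by linarith
  set s : ℝ := ((κ : ℝ) - 1) / κ with hs
  have hs0 : 0 ≤ s := div_nonneg (by linarith) hκpos.le
  have hs1 : s < 1 := by rw [hs, div_lt_one hκpos]; linarith
  set J : ℝ := ∫ t, truncatedKernel s t with hJ
  have hJ0 : 0 ≤ J := integral_nonneg (truncatedKernel_nonneg s)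
  refine ⟨τ₀, hτ₀, E ^ (-s) * (1 + 2 * J), by positivity, ?_⟩
  intro h _ hint hbdd β hβ hβτ
  obtain ⟨a, b, hab⟩ := hlow β hβ hβτ
  have hβ0 : 0 < |β| := abs_pos.2 hβ
  set r : ℝ := |β| ^ (1 / (κ : ℝ)) with hr
  have hr0 : 0 < r := rpow_pos_of_pos hβ0 _
  have hrs : |β| ^ (-(((κ : ℝ) - 1) / (κ : ℝ) ^ 2)) = r ^ (-s) := by
    rw [hr, ← rpow_mul hβ0.le]
    congr 1
    rw [hs]
    field_simp
  have hEr : 0 < E * r := by positivity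
  set N : ℝ := (eLpNorm h ⊤ volume).toReal with hN
  have hN0 : 0 ≤ N := ENNReal.toReal_nonneg
  have hhN : ∀ᵐ ξ, ‖h ξ‖ ≤ N := by
    filter_upwards [enorm_ae_le_eLpNormEssSup h volume] with ξ hξ
    rw [← eLpNorm_exponent_top] at hξ
    rw [hN, ← toReal_enorm]
    exact ENNReal.toReal_mono hbdd hξ
  set F : ℝ → ℝ := fun ξ => (E * r) ^ (-s) *
    (‖h ξ‖ + (N * truncatedKernel s (ξ - a) + N * truncatedKernel s (ξ - b))) with hF
  have hg := integrable_truncatedKernel hs1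
  have hga := (hg.comp_sub_right a).const_mul N
  have hgb := (hg.comp_sub_right b).const_mul N
  have hFint : Integrable F := (hint.norm.add (hga.add hgb)).const_mul _
  have hF0 : ∀ ξ, 0 ≤ F ξ := fun ξ => by
    have := truncatedKernel_nonneg s (ξ - a)
    have := truncatedKernel_nonneg s (ξ - b)
    positivity
  have hFval : ∫ ξ, F ξ = (E * r) ^ (-s) * ((∫ ξ, ‖h ξ‖) + (N * J + N * J)) := by
    have h1 : ∫ ξ, N * truncatedKernel s (ξ - a) + N * truncatedKernel s (ξ - b) =
        N * J + N * J := by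
      rw [integral_add hga hgb, integral_const_mul, integral_const_mul,
        integral_sub_right_eq_self (truncatedKernel s),
        integral_sub_right_eq_self (truncatedKernel s)]
    rw [hF, integral_const_mul, ← h1]
    exact congrArg _ (integral_add hint.norm (hga.add hgb))
  have hpt : ∀ᵐ ξ, ENNReal.ofReal ‖h ξ‖ / ENNReal.ofReal (|1 + β * P κ d ξ| ^ s) ≤
      ENNReal.ofReal (F ξ) := by
    filter_upwards [hhN, Measure.ae_ne volume a, Measure.ae_ne volume b] with ξ hξ hξa hξb
    have hta : ξ - a ≠ 0 := sub_ne_zero.2 hξa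
    have htb : ξ - b ≠ 0 := sub_ne_zero.2 hξb
    have hka := mul_nonneg hN0 (truncatedKernel_nonneg s (ξ - a))
    have hkb := mul_nonneg hN0 (truncatedKernel_nonneg s (ξ - b))
    have key : ∀ w : ℝ, 0 < w → E * r * w ≤ |1 + β * P κ d ξ| →
        ‖h ξ‖ * w ^ (-s) ≤
          ‖h ξ‖ + (N * truncatedKernel s (ξ - a) + N * truncatedKernel s (ξ - b)) →
        ENNReal.ofReal ‖h ξ‖ / ENNReal.ofReal (|1 + β * P κ d ξ| ^ s) ≤
          ENNReal.ofReal (F ξ) := by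
      intro w hw hle hbound
      have hpos : 0 < |1 + β * P κ d ξ| := lt_of_lt_of_le (by positivity) hle
      rw [← ENNReal.ofReal_div_of_pos (rpow_pos_of_pos hpos _)]
      apply ENNReal.ofReal_le_ofReal
      calc ‖h ξ‖ / |1 + β * P κ d ξ| ^ s ≤ ‖h ξ‖ / (E * r * w) ^ s := by gcongr
        _ = (E * r) ^ (-s) * (‖h ξ‖ * w ^ (-s)) := by
          rw [mul_rpow hEr.le hw.le, rpow_neg hEr.le, rpow_neg hw.le]
          field_simp
        _ ≤ F ξ := mul_le_mul_of_nonneg_left hbound (rpow_nonneg hEr.le _)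
    rcases hab ξ with h1 | h1 | h1
    · refine key 1 one_pos (by rwa [mul_one]) ?_
      rw [one_rpow]
      linarith
    · refine key _ (abs_pos.2 hta) h1 ?_
      linarith [mul_abs_rpow_neg_le hs0 hta (norm_nonneg (h ξ)) hξ]
    · refine key _ (abs_pos.2 htb) h1 ?_
      linarith [mul_abs_rpow_neg_le hs0 htb (norm_nonneg (h ξ)) hξ]
  refine (lintegral_mono_ae hpt).trans ?_
  rw [← ofReal_integral_eq_lintegral_ofReal hFint (Filter.Eventually.of_forall hF0), hFval, hrs,
    mul_rpow hE.le hr0.le]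
  apply ENNReal.ofReal_le_ofReal
  have hI : 0 ≤ ∫ ξ, ‖h ξ‖ := integral_nonneg fun _ => norm_nonneg _
  have hc : 0 ≤ E ^ (-s) * r ^ (-s) := by positivity
  have hmain : (∫ ξ, ‖h ξ‖) + (N * J + N * J) ≤ (1 + 2 * J) * ((∫ ξ, ‖h ξ‖) + N) := by
    nlinarith [mul_nonneg hI hJ0]
  calc E ^ (-s) * r ^ (-s) * ((∫ ξ, ‖h ξ‖) + (N * J + N * J))
      ≤ E ^ (-s) * r ^ (-s) * ((1 + 2 * J) * ((∫ ξ, ‖h ξ‖) + N)) :=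
        mul_le_mul_of_nonneg_left hmain hc
    _ = E ^ (-s) * (1 + 2 * J) * ((∫ ξ, ‖h ξ‖) + N) * r ^ (-s) := by ring
end

section
/- Fix an integer κ ≥ 2, real coefficients d_{κ−2j} with d_κ = 1 defining P, α ∈ [0,κ], T > 0, ε > 0, τ > 0 and ρ ∈ L¹(ℝ,ℂ). Let F : [0,T] × ℝ → ℂ be measurable with sup_{0≤z≤T} ∫_ℝ |F(z,ξ)| dξ < ∞. Define the iterates F₀ := F and F_{m+1}(z,ξ) := ∫_0^z e^{−i(z−s)ε^α P(ξ)} ( ∫_ℝ ρ(ξ₁) F_m(s, ξ − ξ₁/ε) dξ₁ ) ds, and, with ⌊z⌋_τ := τ⌊z/τ⌋, the iterates G₀ := F and G_{m+1}(z,ξ) := ∫_0^{⌊z⌋_τ} e^{−i(⌊z⌋_τ − s)ε^α P(ξ)} ( ∫_ℝ ρ(ξ₁) G_m(s, ξ − ξ₁/ε) dξ₁ ) ds. Then for every integer m ≥ 0 and every z ∈ [0,T], ∫_ℝ |F_m(z,ξ)| dξ + ∫_ℝ |G_m(z,ξ)| dξ ≤ 2 · (‖ρ‖_{L¹} T)^m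 / m! · sup_{0≤s≤z} ∫_ℝ |F(s,ξ)| dξ. -/
open MeasureTheory Real
open scoped ENNReal NNReal

/-- Fourier-side iterates of the continuous Duhamel integral operator `ℐ`:
`F₀ = F`, `F_{m+1}(z,ξ) = ∫₀^z e^{−i(z−s)ε^αP(ξ)} (∫ ρ(ξ₁) F_m(s,ξ−ξ₁/ε) dξ₁) ds`. -/
noncomputable def iterF (κ : ℕ) (d : ℕ → ℝ) (ρ : ℝ → ℂ) (ε α : ℝ)
    (F : ℝ → ℝ → ℂ) : ℕ → ℝ → ℝ → ℂ
  | 0 => F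
  | m + 1 => fun z ξ =>
      ∫ s in (0:ℝ)..z,
        Complex.exp (-Complex.I * Complex.ofReal ((z - s) * ε ^ α * P κ d ξ)) *
          ∫ ξ₁ : ℝ, ρ ξ₁ * iterF κ d ρ ε α F m s (ξ - ξ₁ / ε)

/-- Fourier-side iterates of the discrete Duhamel integral operator `ℐ_d`, with
`⌊z⌋_τ = τ⌊z/τ⌋`:
`G₀ = F`, `G_{m+1}(z,ξ) = ∫₀^{⌊z⌋_τ} e^{−i(⌊z⌋_τ−s)ε^αP(ξ)} (∫ ρ(ξ₁) G_m(s,ξ−ξ₁/ε) dξ₁) ds`. -/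
noncomputable def iterG (κ : ℕ) (d : ℕ → ℝ) (ρ : ℝ → ℂ) (ε α τ : ℝ)
    (F : ℝ → ℝ → ℂ) : ℕ → ℝ → ℝ → ℂ
  | 0 => F
  | m + 1 => fun z ξ =>
      ∫ s in (0:ℝ)..(τ * (⌊z / τ⌋ : ℝ)),
        Complex.exp (-Complex.I *
            Complex.ofReal ((τ * (⌊z / τ⌋ : ℝ) - s) * ε ^ α * P κ d ξ)) *
          ∫ ξ₁ : ℝ, ρ ξ₁ * iterG κ d ρ ε α τ F m s (ξ - ξ₁ / ε)

/-- One step of the Duhamel iteration, with upper integration limit `e z`. -/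
noncomputable def duhamelStep (κ : ℕ) (d : ℕ → ℝ) (ρ : ℝ → ℂ) (ε α : ℝ) (e : ℝ → ℝ)
    (H : ℝ → ℝ → ℂ) : ℝ → ℝ → ℂ := fun z ξ =>
  ∫ s in (0:ℝ)..(e z),
    Complex.exp (-Complex.I * Complex.ofReal ((e z - s) * ε ^ α * P κ d ξ)) *
      ∫ ξ₁ : ℝ, ρ ξ₁ * H s (ξ - ξ₁ / ε)

theorem measurable_P (κ : ℕ) (d : ℕ → ℝ) : Measurable (P κ d) := by
  unfold P
  fun_prop

theorem duhamelStep_congr_ae {κ : ℕ} {d : ℕ → ℝ} {ρ ρ' : ℝ → ℂ} (h : ρ =ᵐ[volume] ρ')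
    (ε α : ℝ) (e : ℝ → ℝ) (H : ℝ → ℝ → ℂ) :
    duhamelStep κ d ρ ε α e H = duhamelStep κ d ρ' ε α e H := by
  have key : ∀ s ξ : ℝ, ∫ ξ₁ : ℝ, ρ ξ₁ * H s (ξ - ξ₁ / ε) = ∫ ξ₁ : ℝ, ρ' ξ₁ * H s (ξ - ξ₁ / ε) := by
    intro s ξ
    refine integral_congr_ae ?_
    filter_upwards [h] with x hx
    rw [hx]
  unfold duhamelStep
  simp only [key]

theorem measurable_convolution_integral {ρ : ℝ → ℂ} (hρ : Measurable ρ) (ε : ℝ)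
    {H : ℝ → ℝ → ℂ} (hH : Measurable (Function.uncurry H)) :
    Measurable fun p : ℝ × ℝ => ∫ ξ₁ : ℝ, ρ ξ₁ * H p.1 (p.2 - ξ₁ / ε) := by
  have h : Measurable fun q : (ℝ × ℝ) × ℝ => ρ q.2 * H q.1.1 (q.1.2 - q.2 / ε) :=
    (hρ.comp measurable_snd).mul
      (hH.comp (f := fun q : (ℝ × ℝ) × ℝ => (q.1.1, q.1.2 - q.2 / ε)) (by fun_prop))
  exact (h.stronglyMeasurable.integral_prod_right').measurable

theorem measurable_integral_Ioc {X : Type*} [MeasurableSpace X] {a b : X → ℝ}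
    (ha : Measurable a) (hb : Measurable b) {f : X × ℝ → ℂ} (hf : Measurable f) :
    Measurable fun x => ∫ s in Set.Ioc (a x) (b x), f (x, s) := by
  have hset : MeasurableSet {q : X × ℝ | a q.1 < q.2 ∧ q.2 ≤ b q.1} :=
    (measurableSet_lt (ha.comp measurable_fst) measurable_snd).inter
      (measurableSet_le measurable_snd (hb.comp measurable_fst))
  have h := ((hf.indicator hset).stronglyMeasurable.integral_prod_right'
    (ν := (volume : Measure ℝ))).measurable
  convert h using 2 with x
  rw [← integral_indicator measurableSet_Ioc]
  rfl

theorem measurable_duhamelStep (κ : ℕ) (d : ℕ → ℝ) {ρ : ℝ → ℂ} (hρ : Measurable ρ)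
    (ε α : ℝ) {e : ℝ → ℝ} (he : Measurable e) {H : ℝ → ℝ → ℂ}
    (hH : Measurable (Function.uncurry H)) :
    Measurable (Function.uncurry (duhamelStep κ d ρ ε α e H)) := by
  have hP := measurable_P κ d
  have hI := measurable_convolution_integral hρ ε hH
  have hf : Measurable fun q : (ℝ × ℝ) × ℝ =>
      Complex.exp (-Complex.I * Complex.ofReal ((e q.1.1 - q.2) * ε ^ α * P κ d q.1.2)) *
        ∫ ξ₁ : ℝ, ρ ξ₁ * H q.2 (q.1.2 - ξ₁ / ε) := by
    refine Measurable.mul (by fun_prop) ?_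
    exact hI.comp (f := fun q : (ℝ × ℝ) × ℝ => (q.2, q.1.2)) (by fun_prop)
  have he' : Measurable fun p : ℝ × ℝ => e p.1 := he.comp measurable_fst
  exact (measurable_integral_Ioc measurable_const he' hf).sub
    (measurable_integral_Ioc he' measurable_const hf)

theorem lintegral_enorm_convolution_le {ρ : ℝ → ℂ} (hρ : Measurable ρ) (ε : ℝ)
    {h : ℝ → ℂ} (hh : Measurable h) :
    ∫⁻ ξ : ℝ, ‖∫ ξ₁ : ℝ, ρ ξ₁ * h (ξ - ξ₁ / ε)‖ₑ ≤ (∫⁻ x, ‖ρ x‖ₑ) * ∫⁻ ξ, ‖h ξ‖ₑ := by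
  calc ∫⁻ ξ : ℝ, ‖∫ ξ₁ : ℝ, ρ ξ₁ * h (ξ - ξ₁ / ε)‖ₑ
      ≤ ∫⁻ ξ : ℝ, ∫⁻ ξ₁ : ℝ, ‖ρ ξ₁ * h (ξ - ξ₁ / ε)‖ₑ :=
        lintegral_mono fun ξ => enorm_integral_le_lintegral_enorm _
    _ = ∫⁻ ξ₁ : ℝ, ∫⁻ ξ : ℝ, ‖ρ ξ₁ * h (ξ - ξ₁ / ε)‖ₑ := by
        refine lintegral_lintegral_swap (Measurable.aemeasurable ?_)
        unfold Function.uncurry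
        fun_prop
    _ = ∫⁻ ξ₁ : ℝ, ‖ρ ξ₁‖ₑ * ∫⁻ ξ, ‖h ξ‖ₑ := by
        refine lintegral_congr fun ξ₁ => ?_
        simp only [enorm_mul]
        rw [lintegral_const_mul _ (by fun_prop),
          lintegral_sub_right_eq_self (fun ξ => ‖h ξ‖ₑ) (ξ₁ / ε)]
    _ = _ := lintegral_mul_const _ (by fun_prop)

theorem lintegral_enorm_duhamelStep_le (κ : ℕ) (d : ℕ → ℝ) {ρ : ℝ → ℂ} (hρ : Measurable ρ)
    (ε α : ℝ) {e : ℝ → ℝ} {H : ℝ → ℝ → ℂ} (hH : Measurable (Function.uncurry H))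
    {z : ℝ} (hz : 0 ≤ e z) :
    ∫⁻ ξ, ‖duhamelStep κ d ρ ε α e H z ξ‖ₑ ≤
      ∫⁻ s in Set.Ioc 0 (e z), (∫⁻ x, ‖ρ x‖ₑ) * ∫⁻ ξ, ‖H s ξ‖ₑ := by
  have hI := measurable_convolution_integral hρ ε hH
  calc ∫⁻ ξ, ‖duhamelStep κ d ρ ε α e H z ξ‖ₑ
      ≤ ∫⁻ ξ, ∫⁻ s in Set.Ioc 0 (e z), ‖∫ ξ₁ : ℝ, ρ ξ₁ * H s (ξ - ξ₁ / ε)‖ₑ := by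
        refine lintegral_mono fun ξ => ?_
        unfold duhamelStep
        rw [intervalIntegral.integral_of_le hz]
        refine (enorm_integral_le_lintegral_enorm _).trans (le_of_eq ?_)
        refine lintegral_congr fun s => ?_
        have hexp : ‖Complex.exp
            (-Complex.I * Complex.ofReal ((e z - s) * ε ^ α * P κ d ξ))‖ₑ = 1 := by
          rw [← ofReal_norm, Complex.norm_exp]
          simp
        rw [enorm_mul, hexp, one_mul]
    _ = ∫⁻ s in Set.Ioc 0 (e z), ∫⁻ ξ, ‖∫ ξ₁ : ℝ, ρ ξ₁ * H s (ξ - ξ₁ / ε)‖ₑ := by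
        refine lintegral_lintegral_swap (Measurable.aemeasurable ?_)
        exact (hI.comp measurable_swap).enorm
    _ ≤ _ := lintegral_mono fun s =>
        lintegral_enorm_convolution_le hρ ε (hH.comp measurable_prodMk_left)

theorem setLIntegral_Ioc_pow_div_factorial {R z : ℝ} (hR : 0 ≤ R) (hz : 0 ≤ z) (m : ℕ) :
    ∫⁻ s in Set.Ioc 0 z, ENNReal.ofReal R * ENNReal.ofReal ((R * s) ^ m / (m.factorial : ℝ)) =
      ENNReal.ofReal ((R * z) ^ (m + 1) / ((m + 1).factorial : ℝ)) := by
  simp only [← ENNReal.ofReal_mul hR]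
  rw [← ofReal_integral_eq_lintegral_ofReal
    (Continuous.integrableOn_Ioc (by fun_prop))
    ((ae_restrict_iff' measurableSet_Ioc).2 (.of_forall fun s hs => by
      have := hs.1.le
      simp only [Pi.zero_apply]
      positivity)), ← intervalIntegral.integral_of_le hz]
  congr 1
  simp only [mul_pow, mul_div_right_comm, ← mul_assoc, intervalIntegral.integral_const_mul,
    integral_pow, Nat.factorial_succ]
  push_cast
  field_simp
  simp only [ne_eq, Nat.add_eq_zero_iff, one_ne_zero, and_false, not_false_eq_true, zero_pow, sub_zero]
  ring

/-- A sequence generated by Duhamel steps whose upper limits satisfy `0 ≤ e z ≤ z` for `z ≥ 0`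
has `L¹` norms growing at most like those of an exponential series. -/
theorem lintegral_enorm_duhamel_iterate_le (κ : ℕ) (d : ℕ → ℝ) {ρ : ℝ → ℂ} (hρ : Integrable ρ)
    (ε α : ℝ) {e : ℝ → ℝ} (he : Measurable e) (he0 : ∀ z, 0 ≤ z → 0 ≤ e z)
    (hez : ∀ z, 0 ≤ z → e z ≤ z) {H : ℕ → ℝ → ℝ → ℂ} (hH : Measurable (Function.uncurry (H 0)))
    (hstep : ∀ m, H (m + 1) = duhamelStep κ d ρ ε α e (H m)) (m : ℕ) {z : ℝ} (hz : 0 ≤ z) :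
    ∫⁻ ξ, ‖H m z ξ‖ₑ ≤ ENNReal.ofReal (((∫ x, ‖ρ x‖) * z) ^ m / (m.factorial : ℝ)) *
      ⨆ s ∈ Set.Icc (0:ℝ) z, ∫⁻ ξ, ‖H 0 s ξ‖ₑ := by
  obtain ⟨ρ', hρ', hae⟩ := hρ.aestronglyMeasurable
  have hρ'm := hρ'.measurable
  have hR : 0 ≤ ∫ x, ‖ρ x‖ := integral_nonneg fun _ => norm_nonneg _
  have hnorm : ∫⁻ x, ‖ρ' x‖ₑ = ENNReal.ofReal (∫ x, ‖ρ x‖) := by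
    rw [ofReal_integral_norm_eq_lintegral_enorm hρ]
    refine lintegral_congr_ae ?_
    filter_upwards [hae] with x hx
    rw [hx]
  simp only [duhamelStep_congr_ae hae] at hstep
  have hmeas : ∀ m, Measurable (Function.uncurry (H m)) := by
    intro m
    induction m with
    | zero => exact hH
    | succ m ih =>
      rw [hstep]
      exact measurable_duhamelStep κ d hρ'm ε α he ih
  induction m generalizing z with
  | zero =>
    simpa using le_iSup₂_of_le (f := fun s (_ : s ∈ Set.Icc (0:ℝ) z) => ∫⁻ ξ, ‖H 0 s ξ‖ₑ)
      z ⟨hz, le_rfl⟩ le_rfl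
  | succ m ih =>
    rw [hstep]
    refine (lintegral_enorm_duhamelStep_le κ d hρ'm ε α (hmeas m) (he0 z hz)).trans ?_
    rw [hnorm, ← setLIntegral_Ioc_pow_div_factorial hR hz, ← lintegral_mul_const _ (by fun_prop)]
    refine (lintegral_mono_set (Set.Ioc_subset_Ioc_right (hez z hz))).trans ?_
    refine setLIntegral_mono' measurableSet_Ioc fun s hs => ?_
    rw [mul_assoc]
    gcongr
    refine (ih hs.1.le).trans ?_
    refine mul_le_mul_right (biSup_mono fun t ht => ⟨ht.1, ht.2.trans hs.2⟩) _

/-- Stability of the iterated Duhamel operators: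
`∫|F_m(z)| + ∫|G_m(z)| ≤ 2 (‖ρ‖₁ T)^m / m! ⋅ sup_{0≤s≤z} ∫|F(s)|`. -/
theorem iterated_duhamel_stability (κ : ℕ) (hκ : 2 ≤ κ) (d : ℕ → ℝ) (hd : d κ = 1)
    (α : ℝ) (hα : α ∈ Set.Icc (0:ℝ) (κ : ℝ)) (T : ℝ) (hT : 0 < T)
    (ε : ℝ) (hε : 0 < ε) (τ : ℝ) (hτ : 0 < τ)
    (ρ : ℝ → ℂ) (hρ1 : Integrable ρ)
    (F : ℝ → ℝ → ℂ) (hFm : Measurable (Function.uncurry F))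
    (hFb : ∃ M : ℝ, ∀ z ∈ Set.Icc (0:ℝ) T,
      (∫⁻ ξ : ℝ, (‖F z ξ‖₊ : ℝ≥0∞)) ≤ ENNReal.ofReal M) :
    ∀ m : ℕ, ∀ z ∈ Set.Icc (0:ℝ) T,
      (∫⁻ ξ : ℝ, (‖iterF κ d ρ ε α F m z ξ‖₊ : ℝ≥0∞)) +
        (∫⁻ ξ : ℝ, (‖iterG κ d ρ ε α τ F m z ξ‖₊ : ℝ≥0∞)) ≤
      2 * ENNReal.ofReal (((∫ x : ℝ, ‖ρ x‖) * T) ^ m / (m.factorial : ℝ)) *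
        ⨆ s ∈ Set.Icc (0:ℝ) z, ∫⁻ ξ : ℝ, (‖F s ξ‖₊ : ℝ≥0∞) := by
  intro m z hz
  have hR : 0 ≤ ∫ x, ‖ρ x‖ := integral_nonneg fun _ => norm_nonneg _
  have hmono : ENNReal.ofReal (((∫ x, ‖ρ x‖) * z) ^ m / (m.factorial : ℝ)) ≤
      ENNReal.ofReal (((∫ x, ‖ρ x‖) * T) ^ m / (m.factorial : ℝ)) := by
    have h0 := hz.1
    have h1 := hz.2
    gcongr
  have hbF := lintegral_enorm_duhamel_iterate_le κ d hρ1 ε α (e := fun z => z)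
    (H := iterF κ d ρ ε α F) measurable_id (fun _ h => h) (fun _ _ => le_rfl) hFm
    (fun _ => rfl) m hz.1
  have hbG := lintegral_enorm_duhamel_iterate_le κ d hρ1 ε α
    (e := fun z => τ * (⌊z / τ⌋ : ℝ)) (H := iterG κ d ρ ε α τ F)
    (by fun_prop)
    (fun z h => mul_nonneg hτ.le (Int.cast_nonneg (Int.floor_nonneg.2 (div_nonneg h hτ.le))))
    (fun z _ => (mul_le_mul_of_nonneg_left (Int.floor_le _) hτ.le).trans_eq
      (mul_div_cancel₀ z hτ.ne')) hFm
    (fun _ => rfl) m hz.1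
  rw [two_mul, add_mul]
  exact add_le_add (hbF.trans (mul_le_mul_left hmono _)) (hbG.trans (mul_le_mul_left hmono _))
end
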